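/- arXiv:2401.02805 — 11 statements merged into one kernel-verified Lean document; each statement's English description precedes it below -/
import Mathlib

section
/- In 𝔨, set Y = √13·Z₂ − 2·W₂, u₁ = √13·W₂ + 2·Z₂, u₂ = W₁ + Z₃, u₃ = W₃ + Z₁, u₄ = W₁ − Z₃, u₅ = W₃ − Z₁. Then [Y, u₁] = 0, [Y, u₂] = ((√13+2)/2)·u₃, [Y, u₃] = −((√13+2)/2)·u₂, [Y, u₄] = −((√13−2)/2)·u₅, and [Y, u₅] = ((√13−2)/2)·u₄. In particular the three subspaces span{u₁}, span{u₂, u₃} and span{u₄, u₅} are invariant under ad(Y). -/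
/-- If bracketing with `y` maps a set into its span, it leaves that span invariant. -/
theorem lie_mem_span_of_forall_mem {R L : Type*} [CommRing R] [LieRing L] [LieAlgebra R L]
    {y : L} {s : Set L} (h : ∀ x ∈ s, ⁅y, x⁆ ∈ Submodule.span R s) :
    ∀ v ∈ Submodule.span R s, ⁅y, v⁆ ∈ Submodule.span R s := by
  have hle : Submodule.span R s ≤ (Submodule.span R s).comap (LieAlgebra.ad R L y) :=
    Submodule.span_le.2 h
  exact hle

/-- Bracket relations of `Y = √13·Z₂ − 2·W₂` with `u₁, …, u₅`, and invariance of the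
three subspaces under `ad(Y)`. -/
theorem stmt_4 (L : Type) [LieRing L] [LieAlgebra ℝ L]
    (W1 W2 W3 Z1 Z2 Z3 : L)
    (h1 : ⁅W1, W2⁆ = (1/2 : ℝ) • W3)
    (h2 : ⁅W2, W3⁆ = (1/2 : ℝ) • W1)
    (h3 : ⁅W1, W3⁆ = -((1/2 : ℝ) • W2))
    (h4 : ⁅W1, Z1⁆ = (1/2 : ℝ) • Z2)
    (h5 : ⁅W1, Z2⁆ = -((1/2 : ℝ) • Z1))
    (h6 : ⁅W2, Z1⁆ = (1/2 : ℝ) • Z3)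
    (h7 : ⁅W2, Z3⁆ = -((1/2 : ℝ) • Z1))
    (h8 : ⁅W3, Z2⁆ = (1/2 : ℝ) • Z3)
    (h9 : ⁅W3, Z3⁆ = -((1/2 : ℝ) • Z2))
    (h10 : ⁅Z1, Z2⁆ = (1/2 : ℝ) • W1)
    (h11 : ⁅Z1, Z3⁆ = (1/2 : ℝ) • W2)
    (h12 : ⁅Z2, Z3⁆ = (1/2 : ℝ) • W3)
    (h13 : ⁅W1, Z3⁆ = 0)
    (h14 : ⁅W2, Z2⁆ = 0)
    (h15 : ⁅W3, Z1⁆ = 0)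
    (u1 u2 u3 u4 u5 : L)
    (hu1 : u1 = Real.sqrt 13 • W2 + (2 : ℝ) • Z2)
    (hu2 : u2 = W1 + Z3)
    (hu3 : u3 = W3 + Z1)
    (hu4 : u4 = W1 - Z3)
    (hu5 : u5 = W3 - Z1)
    (Y : L) (hY : Y = Real.sqrt 13 • Z2 - (2 : ℝ) • W2) :
    ⁅Y, u1⁆ = 0 ∧
    ⁅Y, u2⁆ = ((Real.sqrt 13 + 2) / 2) • u3 ∧
    ⁅Y, u3⁆ = -(((Real.sqrt 13 + 2) / 2) • u2) ∧
    ⁅Y, u4⁆ = -(((Real.sqrt 13 - 2) / 2) • u5) ∧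
    ⁅Y, u5⁆ = ((Real.sqrt 13 - 2) / 2) • u4 ∧
    (∀ v ∈ Submodule.span ℝ ({u1} : Set L), ⁅Y, v⁆ ∈ Submodule.span ℝ ({u1} : Set L)) ∧
    (∀ v ∈ Submodule.span ℝ ({u2, u3} : Set L),
      ⁅Y, v⁆ ∈ Submodule.span ℝ ({u2, u3} : Set L)) ∧
    (∀ v ∈ Submodule.span ℝ ({u4, u5} : Set L),
      ⁅Y, v⁆ ∈ Submodule.span ℝ ({u4, u5} : Set L)) := by
  have g1 : ⁅W2, W1⁆ = -((1/2 : ℝ) • W3) := by rw [← lie_skew, h1]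
  have g5 : ⁅Z2, W1⁆ = (1/2 : ℝ) • Z1 := by rw [← lie_skew, h5, neg_neg]
  have g8 : ⁅Z2, W3⁆ = -((1/2 : ℝ) • Z3) := by rw [← lie_skew, h8]
  have g10 : ⁅Z2, Z1⁆ = -((1/2 : ℝ) • W1) := by rw [← lie_skew, h10]
  have g14 : ⁅Z2, W2⁆ = 0 := by rw [← lie_skew, h14, neg_zero]
  have e1 : ⁅Y, u1⁆ = 0 := by
    simp [hY, hu1, h14, g14]
  have e2 : ⁅Y, u2⁆ = ((Real.sqrt 13 + 2) / 2) • u3 := by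
    simp only [hY, hu2, hu3, sub_lie, lie_add, smul_lie, g5, h12, g1, h7]
    module
  have e3 : ⁅Y, u3⁆ = -(((Real.sqrt 13 + 2) / 2) • u2) := by
    simp only [hY, hu2, hu3, sub_lie, lie_add, smul_lie, g8, g10, h2, h6]
    module
  have e4 : ⁅Y, u4⁆ = -(((Real.sqrt 13 - 2) / 2) • u5) := by
    simp only [hY, hu4, hu5, sub_lie, lie_sub, smul_lie, g5, h12, g1, h7]
    module
  have e5 : ⁅Y, u5⁆ = ((Real.sqrt 13 - 2) / 2) • u4 := by
    simp only [hY, hu4, hu5, sub_lie, lie_sub, smul_lie, g8, g10, h2, h6]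
    module
  refine ⟨e1, e2, e3, e4, e5, lie_mem_span_of_forall_mem ?_, lie_mem_span_of_forall_mem ?_,
    lie_mem_span_of_forall_mem ?_⟩
  · rintro x rfl
    rw [e1]
    exact zero_mem _
  · rintro x (rfl | rfl)
    · rw [e2]
      exact Submodule.smul_mem _ _ (Submodule.subset_span (by simp))
    · rw [e3]
      exact neg_mem (Submodule.smul_mem _ _ (Submodule.subset_span (by simp)))
  · rintro x (rfl | rfl)
    · rw [e4]
      exact neg_mem (Submodule.smul_mem _ _ (Submodule.subset_span (by simp)))
    · rw [e5]
      exact Submodule.smul_mem _ _ (Submodule.subset_span (by simp))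
end

section
/- In 𝔨, set u₁ = √13·W₂ + 2·Z₂, u₂ = W₁ + Z₃, u₃ = W₃ + Z₁, u₄ = W₁ − Z₃, u₅ = W₃ − Z₁, let μ₁, μ₂, μ₃ > 0, and let A be the linear map on span{u₁,…,u₅} with A u₁ = μ₁u₁, A u₂ = μ₂u₂, A u₃ = μ₂u₃, A u₄ = μ₃u₄, A u₅ = μ₃u₅. Let X₀ = u₁ + u₂ + u₅ = √13·W₂ + 2·Z₂ + W₁ + Z₃ + W₃ − Z₁. If there exists λ ∈ ℝ such that [λ(√13·Z₂ − 2·W₂) + X₀, A X₀] = 0 in 𝔨, then μ₁·((2+√13)²μ₂ + (2−√13)²μ₃) = 34·μ₂μ₃, i.e. μ₁ = 34μ₂μ₃ / ((2+√13)²μ₂ + (2−√13)²μ₃). -/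
/-- Necessity of the relation `μ₁((2+√13)²μ₂ + (2−√13)²μ₃) = 34μ₂μ₃` for the g.o.
condition of Souris at the vector `X₀ = u₁ + u₂ + u₅` on `𝔽_{α₂}`. -/
theorem stmt_7 (L : Type) [LieRing L] [LieAlgebra ℝ L]
    (W1 W2 W3 Z1 Z2 Z3 : L)
    (h1 : ⁅W1, W2⁆ = (1/2 : ℝ) • W3)
    (h2 : ⁅W2, W3⁆ = (1/2 : ℝ) • W1)
    (h3 : ⁅W1, W3⁆ = -((1/2 : ℝ) • W2))
    (h4 : ⁅W1, Z1⁆ = (1/2 : ℝ) • Z2)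
    (h5 : ⁅W1, Z2⁆ = -((1/2 : ℝ) • Z1))
    (h6 : ⁅W2, Z1⁆ = (1/2 : ℝ) • Z3)
    (h7 : ⁅W2, Z3⁆ = -((1/2 : ℝ) • Z1))
    (h8 : ⁅W3, Z2⁆ = (1/2 : ℝ) • Z3)
    (h9 : ⁅W3, Z3⁆ = -((1/2 : ℝ) • Z2))
    (h10 : ⁅Z1, Z2⁆ = (1/2 : ℝ) • W1)
    (h11 : ⁅Z1, Z3⁆ = (1/2 : ℝ) • W2)
    (h12 : ⁅Z2, Z3⁆ = (1/2 : ℝ) • W3)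
    (h13 : ⁅W1, Z3⁆ = 0)
    (h14 : ⁅W2, Z2⁆ = 0)
    (h15 : ⁅W3, Z1⁆ = 0)
    (hindep : LinearIndependent ℝ ![W1, W2, W3, Z1, Z2, Z3])
    (u1 u2 u3 u4 u5 : L)
    (hu1 : u1 = Real.sqrt 13 • W2 + (2 : ℝ) • Z2)
    (hu2 : u2 = W1 + Z3)
    (hu3 : u3 = W3 + Z1)
    (hu4 : u4 = W1 - Z3)
    (hu5 : u5 = W3 - Z1)
    (μ1 μ2 μ3 : ℝ) (hμ1 : 0 < μ1) (hμ2 : 0 < μ2) (hμ3 : 0 < μ3)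
    (A : L →ₗ[ℝ] L)
    (hA1 : A u1 = μ1 • u1) (hA2 : A u2 = μ2 • u2) (hA3 : A u3 = μ2 • u3)
    (hA4 : A u4 = μ3 • u4) (hA5 : A u5 = μ3 • u5)
    (X0 : L) (hX0 : X0 = u1 + u2 + u5)
    (hgo : ∃ lam : ℝ, ⁅lam • (Real.sqrt 13 • Z2 - (2 : ℝ) • W2) + X0, A X0⁆ = 0) :
    μ1 * ((2 + Real.sqrt 13) ^ 2 * μ2 + (2 - Real.sqrt 13) ^ 2 * μ3) = 34 * (μ2 * μ3) := by
  obtain ⟨lam, hgo⟩ := hgo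
  have hk1 : ⁅Real.sqrt 13 • Z2 - (2 : ℝ) • W2, u1⁆ = 0 := by
    simp only [hu1, sub_lie, lie_add, smul_lie, lie_smul, lie_self, h14, ← lie_skew Z2 W2,
      neg_zero, smul_zero, add_zero, sub_zero]
  have hk2 : ⁅Real.sqrt 13 • Z2 - (2 : ℝ) • W2, u2⁆ = ((Real.sqrt 13 + 2) / 2) • u3 := by
    simp only [hu2, hu3, sub_lie, lie_add, smul_lie, ← lie_skew Z2 W1, ← lie_skew W2 W1, h1, h5,
      h7, h12]
    module
  have hk5 : ⁅Real.sqrt 13 • Z2 - (2 : ℝ) • W2, u5⁆ = ((Real.sqrt 13 - 2) / 2) • u4 := by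
    simp only [hu4, hu5, sub_lie, lie_sub, smul_lie, ← lie_skew Z2 W3, ← lie_skew Z2 Z1, h2, h6,
      h8, h10]
    module
  have h12' : ⁅u1, u2⁆ = (1 - Real.sqrt 13 / 2) • u3 := by
    simp only [hu1, hu2, hu3, add_lie, lie_add, smul_lie, ← lie_skew Z2 W1, ← lie_skew W2 W1, h1,
      h5, h7, h12]
    module
  have h15' : ⁅u1, u5⁆ = (1 + Real.sqrt 13 / 2) • u4 := by
    simp only [hu1, hu4, hu5, add_lie, lie_sub, smul_lie, ← lie_skew Z2 W3, ← lie_skew Z2 Z1, h2,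
      h6, h8, h10]
    module
  have h25 : ⁅u2, u5⁆ = 0 := by
    simp only [hu2, hu5, add_lie, lie_sub, ← lie_skew Z3 W3, ← lie_skew Z3 Z1, h3, h4, h9, h11]
    module
  set a : ℝ := lam * μ2 * ((Real.sqrt 13 + 2) / 2) + (μ2 - μ1) * (1 - Real.sqrt 13 / 2) with ha
  set b : ℝ := lam * μ3 * ((Real.sqrt 13 - 2) / 2) + (μ3 - μ1) * (1 + Real.sqrt 13 / 2) with hb
  have hab : a • u3 + b • u4 = 0 := by
    rw [← hgo, hX0, map_add, map_add, hA1, hA2, hA5]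
    simp only [add_lie, lie_add, smul_lie, lie_smul, lie_self, hk1, hk2, hk5, h12', h15', h25,
      ← lie_skew u2 u1, ← lie_skew u5 u1, ← lie_skew u5 u2, ha, hb]
    module
  have hcoeff := Fintype.linearIndependent_iff.mp hindep ![b, 0, a, a, 0, -b] (by
    rw [← hab, hu3, hu4]
    simp only [Fin.sum_univ_six, Matrix.cons_val]
    module)
  have ha0 : a = 0 := hcoeff 2
  have hb0 : b = 0 := hcoeff 0
  have hsq : Real.sqrt 13 ^ 2 = 13 := Real.sq_sqrt (by norm_num)
  rw [ha] at ha0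
  rw [hb] at hb0
  linear_combination 2 * μ3 * (Real.sqrt 13 - 2) * ha0 - 2 * μ2 * (Real.sqrt 13 + 2) * hb0
    + 2 * μ2 * μ3 * hsq
end

section
/- In 𝔨, set u₁ = √13·W₂ + 2·Z₂, u₂ = W₁ + Z₃, u₃ = W₃ + Z₁, u₄ = W₁ − Z₃, u₅ = W₃ − Z₁, let μ₂, μ₃ > 0, set μ₁ = 34μ₂μ₃ / ((2+√13)²μ₂ + (2−√13)²μ₃), and let A be the linear map on span{u₁,…,u₅} with A u₁ = μ₁u₁, A u₂ = μ₂u₂, A u₃ = μ₂u₃, A u₄ = μ₃u₄, A u₅ = μ₃u₅. Then for every X = x₁u₁ + x₂u₂ + x₃u₃ + x₄u₄ + x₅u₅ (x₁,…,x₅ ∈ ℝ), the number λ = 9x₁(μ₂ − μ₃) / ((2+√13)²μ₂ + (2−√13)²μ₃) satisfies [λ(√13·Z₂ − 2·W₂) + X, A X] = 0 in 𝔨. -/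
/-- Sufficiency: with `μ₁ = 34μ₂μ₃/((2+√13)²μ₂+(2−√13)²μ₃)`, for every `X` the number
`λ = 9x₁(μ₂−μ₃)/((2+√13)²μ₂+(2−√13)²μ₃)` satisfies Souris' g.o. equation. -/
theorem stmt_8 (L : Type) [LieRing L] [LieAlgebra ℝ L]
    (W1 W2 W3 Z1 Z2 Z3 : L)
    (h1 : ⁅W1, W2⁆ = (1/2 : ℝ) • W3)
    (h2 : ⁅W2, W3⁆ = (1/2 : ℝ) • W1)
    (h3 : ⁅W1, W3⁆ = -((1/2 : ℝ) • W2))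
    (h4 : ⁅W1, Z1⁆ = (1/2 : ℝ) • Z2)
    (h5 : ⁅W1, Z2⁆ = -((1/2 : ℝ) • Z1))
    (h6 : ⁅W2, Z1⁆ = (1/2 : ℝ) • Z3)
    (h7 : ⁅W2, Z3⁆ = -((1/2 : ℝ) • Z1))
    (h8 : ⁅W3, Z2⁆ = (1/2 : ℝ) • Z3)
    (h9 : ⁅W3, Z3⁆ = -((1/2 : ℝ) • Z2))
    (h10 : ⁅Z1, Z2⁆ = (1/2 : ℝ) • W1)
    (h11 : ⁅Z1, Z3⁆ = (1/2 : ℝ) • W2)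
    (h12 : ⁅Z2, Z3⁆ = (1/2 : ℝ) • W3)
    (h13 : ⁅W1, Z3⁆ = 0)
    (h14 : ⁅W2, Z2⁆ = 0)
    (h15 : ⁅W3, Z1⁆ = 0)
    (u1 u2 u3 u4 u5 : L)
    (hu1 : u1 = Real.sqrt 13 • W2 + (2 : ℝ) • Z2)
    (hu2 : u2 = W1 + Z3)
    (hu3 : u3 = W3 + Z1)
    (hu4 : u4 = W1 - Z3)
    (hu5 : u5 = W3 - Z1)
    (μ1 μ2 μ3 : ℝ) (hμ2 : 0 < μ2) (hμ3 : 0 < μ3)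
    (hμ1 : μ1 = 34 * μ2 * μ3 /
      ((2 + Real.sqrt 13) ^ 2 * μ2 + (2 - Real.sqrt 13) ^ 2 * μ3))
    (A : L →ₗ[ℝ] L)
    (hA1 : A u1 = μ1 • u1) (hA2 : A u2 = μ2 • u2) (hA3 : A u3 = μ2 • u3)
    (hA4 : A u4 = μ3 • u4) (hA5 : A u5 = μ3 • u5)
    (x1 x2 x3 x4 x5 : ℝ) (X : L)
    (hX : X = x1 • u1 + x2 • u2 + x3 • u3 + x4 • u4 + x5 • u5) :
    ⁅(9 * x1 * (μ2 - μ3) /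
        ((2 + Real.sqrt 13) ^ 2 * μ2 + (2 - Real.sqrt 13) ^ 2 * μ3)) •
          (Real.sqrt 13 • Z2 - (2 : ℝ) • W2) + X, A X⁆ = 0 := by
  have hs : Real.sqrt 13 ^ 2 = 13 := Real.sq_sqrt (by norm_num)
  generalize Real.sqrt 13 = s at *
  have hD : 0 < (2 + s) ^ 2 * μ2 + (2 - s) ^ 2 * μ3 := by
    have : 0 < (2 + s) ^ 2 ∨ 0 < (2 - s) ^ 2 := by
      by_contra! h
      nlinarith
    rcases this with h | h <;> positivity
  set D := (2 + s) ^ 2 * μ2 + (2 - s) ^ 2 * μ3 with hDdef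
  set l := 9 * x1 * (μ2 - μ3) / D with hl
  have e2 : (2 + s) * l * μ2 + (2 - s) * x1 * (μ2 - μ1) = 0 := by
    rw [hl, hμ1]
    field_simp
    rw [hDdef]
    linear_combination x1 * μ2 * (6 * μ3 - 2 * μ2 - s * (μ2 + μ3)) * hs
  have e4 : (s - 2) * l * μ3 + (s + 2) * x1 * (μ3 - μ1) = 0 := by
    rw [hl, hμ1]
    field_simp
    rw [hDdef]
    linear_combination x1 * μ3 * (6 * μ2 - 2 * μ3 + s * (μ2 + μ3)) * hs
  clear_value l D
  have k1 := lie_skew W1 W2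
  have k2 := lie_skew W2 W3
  have k3 := lie_skew W1 W3
  have k4 := lie_skew W1 Z1
  have k5 := lie_skew W1 Z2
  have k6 := lie_skew W2 Z1
  have k7 := lie_skew W2 Z3
  have k8 := lie_skew W3 Z2
  have k9 := lie_skew W3 Z3
  have k10 := lie_skew Z1 Z2
  have k11 := lie_skew Z1 Z3
  have k12 := lie_skew Z2 Z3
  have k13 := lie_skew W1 Z3
  have k14 := lie_skew W2 Z2
  have k15 := lie_skew W3 Z1
  rw [neg_eq_iff_eq_neg] at k1 k2 k3 k4 k5 k6 k7 k8 k9 k10 k11 k12 k13 k14 k15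
  simp only [hX, map_add, map_smul, hA1, hA2, hA3, hA4, hA5]
  simp only [hu1, hu2, hu3, hu4, hu5, lie_add, add_lie, lie_sub, sub_lie, lie_smul, smul_lie,
    lie_self, k1, k2, k3, k4, k5, k6, k7, k8, k9, k10, k11, k12, k13, k14, k15,
    h1, h2, h3, h4, h5, h6, h7, h8, h9, h10, h11, h12, h13, h14, h15]
  match_scalars
  · linear_combination x2 / 2 * e2 - x4 / 2 * e4
  · linear_combination x2 / 2 * e2 + x4 / 2 * e4
  · linear_combination -x3 / 2 * e2 + x5 / 2 * e4
  · linear_combination -x3 / 2 * e2 - x5 / 2 * e4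
  · ring
  · ring
end

section
/- In 𝔨, let X = w₁W₁ + w₂W₂ + w₃W₃ + z₁Z₁ + z₂Z₂ + z₃Z₃ with w₁,w₂,w₃,z₁,z₂,z₃ ∈ ℝ. Then the nine equations [X, w₁W₁] = [X, w₂W₂] = [X, w₃W₃] = [X, z₁Z₁] = [X, z₂Z₂] = [X, z₃Z₃] = 0 and [X, w₁Z₃ + z₃W₁] = [X, w₂Z₂ + z₂W₂] = [X, w₃Z₁ + z₁W₃] = 0 all hold if and only if X ∈ span{W₁, Z₃} ∪ span{W₂, Z₂} ∪ span{W₃, Z₁}, i.e. if and only if (w₂ = w₃ = z₁ = z₂ = 0) or (w₁ = w₃ = z₁ = z₃ = 0) or (w₁ = w₂ = z₂ = z₃ = 0). -/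
/-- Characterization of equigeodesic vectors on the full flag `𝔽_∅` of `𝔤₂`. -/
theorem stmt_9 (L : Type) [LieRing L] [LieAlgebra ℝ L]
    (W1 W2 W3 Z1 Z2 Z3 : L)
    (h1 : ⁅W1, W2⁆ = (1/2 : ℝ) • W3)
    (h2 : ⁅W2, W3⁆ = (1/2 : ℝ) • W1)
    (h3 : ⁅W1, W3⁆ = -((1/2 : ℝ) • W2))
    (h4 : ⁅W1, Z1⁆ = (1/2 : ℝ) • Z2)
    (h5 : ⁅W1, Z2⁆ = -((1/2 : ℝ) • Z1))
    (h6 : ⁅W2, Z1⁆ = (1/2 : ℝ) • Z3)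
    (h7 : ⁅W2, Z3⁆ = -((1/2 : ℝ) • Z1))
    (h8 : ⁅W3, Z2⁆ = (1/2 : ℝ) • Z3)
    (h9 : ⁅W3, Z3⁆ = -((1/2 : ℝ) • Z2))
    (h10 : ⁅Z1, Z2⁆ = (1/2 : ℝ) • W1)
    (h11 : ⁅Z1, Z3⁆ = (1/2 : ℝ) • W2)
    (h12 : ⁅Z2, Z3⁆ = (1/2 : ℝ) • W3)
    (h13 : ⁅W1, Z3⁆ = 0)
    (h14 : ⁅W2, Z2⁆ = 0)
    (h15 : ⁅W3, Z1⁆ = 0)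
    (hindep : LinearIndependent ℝ ![W1, W2, W3, Z1, Z2, Z3])
    (w1 w2 w3 z1 z2 z3 : ℝ) (X : L)
    (hX : X = w1 • W1 + w2 • W2 + w3 • W3 + z1 • Z1 + z2 • Z2 + z3 • Z3) :
    (⁅X, w1 • W1⁆ = 0 ∧ ⁅X, w2 • W2⁆ = 0 ∧ ⁅X, w3 • W3⁆ = 0 ∧
     ⁅X, z1 • Z1⁆ = 0 ∧ ⁅X, z2 • Z2⁆ = 0 ∧ ⁅X, z3 • Z3⁆ = 0 ∧
     ⁅X, w1 • Z3 + z3 • W1⁆ = 0 ∧ ⁅X, w2 • Z2 + z2 • W2⁆ = 0 ∧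
     ⁅X, w3 • Z1 + z1 • W3⁆ = 0) ↔
      ((w2 = 0 ∧ w3 = 0 ∧ z1 = 0 ∧ z2 = 0) ∨
       (w1 = 0 ∧ w3 = 0 ∧ z1 = 0 ∧ z3 = 0) ∨
       (w1 = 0 ∧ w2 = 0 ∧ z2 = 0 ∧ z3 = 0)) := by
  have coeffs_zero : ∀ a b c d e f : ℝ,
      a • W1 + b • W2 + c • W3 + d • Z1 + e • Z2 + f • Z3 = 0 →
      a = 0 ∧ b = 0 ∧ c = 0 ∧ d = 0 ∧ e = 0 ∧ f = 0 := by
    intro a b c d e f h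
    have hg := Fintype.linearIndependent_iff.1 hindep ![a, b, c, d, e, f]
      (by simpa [Fin.sum_univ_succ, add_assoc] using h)
    exact ⟨hg 0, hg 1, hg 2, hg 3, hg 4, hg 5⟩
  have lie_W1 : ⁅X, W1⁆ = (0 : ℝ) • W1 + (w3 / 2) • W2 + (-(w2 / 2)) • W3
      + (z2 / 2) • Z1 + (-(z1 / 2)) • Z2 + (0 : ℝ) • Z3 := by
    simp only [hX, add_lie, smul_lie, lie_self, ← lie_skew W2 W1, ← lie_skew W3 W1,
      ← lie_skew Z1 W1, ← lie_skew Z2 W1, ← lie_skew Z3 W1, h1, h3, h4, h5, h13]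
    module
  have lie_W2 : ⁅X, W2⁆ = (-(w3 / 2)) • W1 + (0 : ℝ) • W2 + (w1 / 2) • W3
      + (z3 / 2) • Z1 + (0 : ℝ) • Z2 + (-(z1 / 2)) • Z3 := by
    simp only [hX, add_lie, smul_lie, lie_self, ← lie_skew W3 W2,
      ← lie_skew Z1 W2, ← lie_skew Z2 W2, ← lie_skew Z3 W2, h1, h2, h6, h7, h14]
    module
  have lie_Z2 : ⁅X, Z2⁆ = (z1 / 2) • W1 + (0 : ℝ) • W2 + (-(z3 / 2)) • W3
      + (-(w1 / 2)) • Z1 + (0 : ℝ) • Z2 + (w3 / 2) • Z3 := by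
    simp only [hX, add_lie, smul_lie, lie_self, ← lie_skew Z3 Z2, h5, h8, h10, h12, h14]
    module
  have lie_Z3 : ⁅X, Z3⁆ = (0 : ℝ) • W1 + (z1 / 2) • W2 + (z2 / 2) • W3
      + (-(w2 / 2)) • Z1 + (-(w3 / 2)) • Z2 + (0 : ℝ) • Z3 := by
    simp only [hX, add_lie, smul_lie, lie_self, h7, h9, h11, h12, h13]
    module
  constructor
  · rintro ⟨eW1, eW2, -, -, eZ2, eZ3, -⟩
    rw [lie_smul, smul_eq_zero] at eW1 eW2 eZ2 eZ3
    rw [lie_W1] at eW1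
    rw [lie_W2] at eW2
    rw [lie_Z2] at eZ2
    rw [lie_Z3] at eZ3
    replace eW1 := eW1.imp_right (coeffs_zero _ _ _ _ _ _)
    replace eW2 := eW2.imp_right (coeffs_zero _ _ _ _ _ _)
    replace eZ2 := eZ2.imp_right (coeffs_zero _ _ _ _ _ _)
    replace eZ3 := eZ3.imp_right (coeffs_zero _ _ _ _ _ _)
    grind
  · have h14' : ⁅Z2, W2⁆ = 0 := by rw [← lie_skew, h14, neg_zero]
    have h13' : ⁅Z3, W1⁆ = 0 := by rw [← lie_skew, h13, neg_zero]
    have h15' : ⁅Z1, W3⁆ = 0 := by rw [← lie_skew, h15, neg_zero]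
    rintro (⟨rfl, rfl, rfl, rfl⟩ | ⟨rfl, rfl, rfl, rfl⟩ | ⟨rfl, rfl, rfl, rfl⟩) <;>
      simp [hX, h13, h14, h15, h13', h14', h15']
end

section
/- In 𝔨, let 𝔪 = span{W₂, W₃, Z₁, Z₂, Z₃} and let π : 𝔨 → 𝔪 be the linear projection onto 𝔪 along span{W₁}. Let X = w₂W₂ + w₃W₃ + z₁Z₁ + z₂Z₂ + z₃Z₃ with w₂,w₃,z₁,z₂,z₃ ∈ ℝ. Then the four equations π([X, z₃Z₃]) = 0, π([X, w₂W₂ + w₃W₃]) = 0, π([X, z₁Z₁ + z₂Z₂]) = 0 and π([X, z₂W₂ − z₁W₃ − w₃Z₁ + w₂Z₂]) = 0 all hold if and only if either w₂ = w₃ = z₁ = z₂ = 0 (i.e. X ∈ span{Z₃}), or z₃ = 0 and w₂z₁ + w₃z₂ = 0. -/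
/-- Characterization of equigeodesic vectors on the flag `𝔽_{α₁}` of `𝔤₂`. -/
theorem stmt_10 (L : Type) [LieRing L] [LieAlgebra ℝ L]
    (W1 W2 W3 Z1 Z2 Z3 : L)
    (h1 : ⁅W1, W2⁆ = (1/2 : ℝ) • W3)
    (h2 : ⁅W2, W3⁆ = (1/2 : ℝ) • W1)
    (h3 : ⁅W1, W3⁆ = -((1/2 : ℝ) • W2))
    (h4 : ⁅W1, Z1⁆ = (1/2 : ℝ) • Z2)
    (h5 : ⁅W1, Z2⁆ = -((1/2 : ℝ) • Z1))
    (h6 : ⁅W2, Z1⁆ = (1/2 : ℝ) • Z3)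
    (h7 : ⁅W2, Z3⁆ = -((1/2 : ℝ) • Z1))
    (h8 : ⁅W3, Z2⁆ = (1/2 : ℝ) • Z3)
    (h9 : ⁅W3, Z3⁆ = -((1/2 : ℝ) • Z2))
    (h10 : ⁅Z1, Z2⁆ = (1/2 : ℝ) • W1)
    (h11 : ⁅Z1, Z3⁆ = (1/2 : ℝ) • W2)
    (h12 : ⁅Z2, Z3⁆ = (1/2 : ℝ) • W3)
    (h13 : ⁅W1, Z3⁆ = 0)
    (h14 : ⁅W2, Z2⁆ = 0)
    (h15 : ⁅W3, Z1⁆ = 0)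
    (hindep : LinearIndependent ℝ ![W1, W2, W3, Z1, Z2, Z3])
    (π : L →ₗ[ℝ] L)
    (hπW1 : π W1 = 0) (hπW2 : π W2 = W2) (hπW3 : π W3 = W3)
    (hπZ1 : π Z1 = Z1) (hπZ2 : π Z2 = Z2) (hπZ3 : π Z3 = Z3)
    (w2 w3 z1 z2 z3 : ℝ) (X : L)
    (hX : X = w2 • W2 + w3 • W3 + z1 • Z1 + z2 • Z2 + z3 • Z3) :
    (π ⁅X, z3 • Z3⁆ = 0 ∧ π ⁅X, w2 • W2 + w3 • W3⁆ = 0 ∧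
     π ⁅X, z1 • Z1 + z2 • Z2⁆ = 0 ∧
     π ⁅X, z2 • W2 - z1 • W3 - w3 • Z1 + w2 • Z2⁆ = 0) ↔
      ((w2 = 0 ∧ w3 = 0 ∧ z1 = 0 ∧ z2 = 0) ∨
       (z3 = 0 ∧ w2 * z1 + w3 * z2 = 0)) := by
  have skew : ∀ {a b c : L}, ⁅a, b⁆ = c → ⁅b, a⁆ = -c := fun {a b c} h => by
    rw [← lie_skew, h]
  have e1 : π ⁅X, z3 • Z3⁆ =
      (z3 / 2) • (z1 • W2 + z2 • W3 - w2 • Z1 - w3 • Z2) := by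
    simp only [hX, add_lie, smul_lie, lie_smul, h7, h9, h11, h12, lie_self, map_add,
      map_smul, map_neg, map_zero, hπW2, hπW3, hπZ1, hπZ2]
    module
  have e2 : π ⁅X, w2 • W2 + w3 • W3⁆ =
      (z3 / 2) • (w2 • Z1 + w3 • Z2) - ((w2 * z1 + w3 * z2) / 2) • Z3 := by
    simp only [hX, add_lie, smul_lie, lie_add, lie_smul, h2, skew h2, skew h6, skew h7,
      skew h8, skew h9, skew h14, skew h15, lie_self, map_add, map_smul, map_neg, map_zero,
      hπW1, hπZ1, hπZ2, hπZ3]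
    module
  have e3 : π ⁅X, z1 • Z1 + z2 • Z2⁆ =
      ((w2 * z1 + w3 * z2) / 2) • Z3 - (z3 / 2) • (z1 • W2 + z2 • W3) := by
    simp only [hX, add_lie, smul_lie, lie_add, lie_smul, h6, h8, h10, skew h10, skew h11,
      skew h12, h14, h15, lie_self, map_add, map_smul, map_neg, map_zero,
      hπW1, hπW2, hπW3, hπZ3]
    module
  have e4 : π ⁅X, z2 • W2 - z1 • W3 - w3 • Z1 + w2 • Z2⁆ =
      (z3 / 2) • (w3 • W2 - w2 • W3 + z2 • Z1 - z1 • Z2) := by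
    simp only [hX, add_lie, smul_lie, lie_add, lie_sub, lie_smul, h2, skew h2, h6, skew h6,
      skew h7, h8, skew h8, skew h9, h10, skew h10, skew h11, skew h12, h14, skew h14, h15,
      skew h15, lie_self, map_add, map_sub, map_smul, map_neg, map_zero,
      hπW1, hπW2, hπW3, hπZ1, hπZ2, hπZ3]
    module
  rw [e1, e2, e3, e4]
  constructor
  · rintro ⟨k1, k2, -, -⟩
    have coords : ∀ a b c d e : ℝ,
        a • W2 + b • W3 + c • Z1 + d • Z2 + e • Z3 = 0 →
          a = 0 ∧ b = 0 ∧ c = 0 ∧ d = 0 ∧ e = 0 := by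
      intro a b c d e h
      have key := Fintype.linearIndependent_iff.mp hindep ![0, a, b, c, d, e] (by
        simpa [Fin.sum_univ_succ, add_assoc] using h)
      exact ⟨key 1, key 2, key 3, key 4, key 5⟩
    obtain ⟨p1, p2, p3, p4, -⟩ := coords (z3 / 2 * z1) (z3 / 2 * z2) (-(z3 / 2 * w2))
      (-(z3 / 2 * w3)) 0 (by rw [← k1]; module)
    obtain ⟨-, -, -, -, p5⟩ := coords 0 0 (z3 / 2 * w2) (z3 / 2 * w3)
      (-((w2 * z1 + w3 * z2) / 2)) (by rw [← k2]; module)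
    by_cases hz : z3 = 0
    · exact Or.inr ⟨hz, by linarith⟩
    · have hz' : z3 / 2 ≠ 0 := div_ne_zero hz two_ne_zero
      exact Or.inl ⟨(mul_eq_zero.mp (neg_eq_zero.mp p3)).resolve_left hz',
        (mul_eq_zero.mp (neg_eq_zero.mp p4)).resolve_left hz',
        (mul_eq_zero.mp p1).resolve_left hz', (mul_eq_zero.mp p2).resolve_left hz'⟩
  · rintro (⟨rfl, rfl, rfl, rfl⟩ | ⟨rfl, h⟩)
    · simp
    · simp [h]
end

section
/- In 𝔨, set u₁ = √13·W₂ + 2·Z₂, u₂ = W₁ + Z₃, u₃ = W₃ + Z₁, u₄ = W₁ − Z₃, u₅ = W₃ − Z₁, let 𝔪 = span{u₁,…,u₅}, and let π : 𝔨 → 𝔪 be the linear projection onto 𝔪 along span{√13·Z₂ − 2·W₂}. Let X = x₁u₁ + x₂u₂ + x₃u₃ + x₄u₄ + x₅u₅ with x₁,…,x₅ ∈ ℝ. Then the three equations π([X, x₁u₁]) = 0, π([X, x₂u₂ + x₃u₃]) = 0 and π([X, x₄u₄ + x₅u₅]) = 0 all hold if and only if x₁ = 0 or x₂ = x₃ =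 x₄ = x₅ = 0, i.e. if and only if X ∈ span{u₁} ∪ span{W₁, W₃, Z₁, Z₃}. -/
/-- Characterization of equigeodesic vectors on the flag `𝔽_{α₂}` of `𝔤₂`. -/
theorem stmt_11 (L : Type) [LieRing L] [LieAlgebra ℝ L]
    (W1 W2 W3 Z1 Z2 Z3 : L)
    (h1 : ⁅W1, W2⁆ = (1/2 : ℝ) • W3)
    (h2 : ⁅W2, W3⁆ = (1/2 : ℝ) • W1)
    (h3 : ⁅W1, W3⁆ = -((1/2 : ℝ) • W2))
    (h4 : ⁅W1, Z1⁆ = (1/2 : ℝ) • Z2)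
    (h5 : ⁅W1, Z2⁆ = -((1/2 : ℝ) • Z1))
    (h6 : ⁅W2, Z1⁆ = (1/2 : ℝ) • Z3)
    (h7 : ⁅W2, Z3⁆ = -((1/2 : ℝ) • Z1))
    (h8 : ⁅W3, Z2⁆ = (1/2 : ℝ) • Z3)
    (h9 : ⁅W3, Z3⁆ = -((1/2 : ℝ) • Z2))
    (h10 : ⁅Z1, Z2⁆ = (1/2 : ℝ) • W1)
    (h11 : ⁅Z1, Z3⁆ = (1/2 : ℝ) • W2)
    (h12 : ⁅Z2, Z3⁆ = (1/2 : ℝ) • W3)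
    (h13 : ⁅W1, Z3⁆ = 0)
    (h14 : ⁅W2, Z2⁆ = 0)
    (h15 : ⁅W3, Z1⁆ = 0)
    (hindep : LinearIndependent ℝ ![W1, W2, W3, Z1, Z2, Z3])
    (u1 u2 u3 u4 u5 : L)
    (hu1 : u1 = Real.sqrt 13 • W2 + (2 : ℝ) • Z2)
    (hu2 : u2 = W1 + Z3)
    (hu3 : u3 = W3 + Z1)
    (hu4 : u4 = W1 - Z3)
    (hu5 : u5 = W3 - Z1)
    (Y : L) (hY : Y = Real.sqrt 13 • Z2 - (2 : ℝ) • W2)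
    (π : L →ₗ[ℝ] L) (hπY : π Y = 0)
    (hπ1 : π u1 = u1) (hπ2 : π u2 = u2) (hπ3 : π u3 = u3)
    (hπ4 : π u4 = u4) (hπ5 : π u5 = u5)
    (x1 x2 x3 x4 x5 : ℝ) (X : L)
    (hX : X = x1 • u1 + x2 • u2 + x3 • u3 + x4 • u4 + x5 • u5) :
    (π ⁅X, x1 • u1⁆ = 0 ∧ π ⁅X, x2 • u2 + x3 • u3⁆ = 0 ∧
     π ⁅X, x4 • u4 + x5 • u5⁆ = 0) ↔
      (x1 = 0 ∨ (x2 = 0 ∧ x3 = 0 ∧ x4 = 0 ∧ x5 = 0)) := by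
  have b12 : ⁅u1, u2⁆ = (1 - √13 / 2) • u3 := by
    rw [hu1, hu2, hu3]
    simp only [add_lie, lie_add, smul_lie, ← lie_skew W2 W1, ← lie_skew Z2 W1, h1, h5, h7, h12]
    module
  have b13 : ⁅u1, u3⁆ = (√13 / 2 - 1) • u2 := by
    rw [hu1, hu2, hu3]
    simp only [add_lie, lie_add, smul_lie, ← lie_skew Z2 W3, ← lie_skew Z2 Z1, h2, h6, h8, h10]
    module
  have b14 : ⁅u1, u4⁆ = -(1 + √13 / 2) • u5 := by
    rw [hu1, hu4, hu5]
    simp only [add_lie, lie_sub, smul_lie, ← lie_skew W2 W1, ← lie_skew Z2 W1, h1, h5, h7, h12]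
    module
  have b15 : ⁅u1, u5⁆ = (1 + √13 / 2) • u4 := by
    rw [hu1, hu4, hu5]
    simp only [add_lie, lie_sub, smul_lie, ← lie_skew Z2 W3, ← lie_skew Z2 Z1, h2, h6, h8, h10]
    module
  have b24 : ⁅u2, u4⁆ = 0 := by
    rw [hu2, hu4]
    simp only [add_lie, lie_sub, lie_self, ← lie_skew Z3 W1, h13]
    module
  have b25 : ⁅u2, u5⁆ = 0 := by
    rw [hu2, hu5]
    simp only [add_lie, lie_sub, ← lie_skew Z3 W3, ← lie_skew Z3 Z1, h3, h4, h9, h11]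
    module
  have b34 : ⁅u3, u4⁆ = 0 := by
    rw [hu3, hu4]
    simp only [add_lie, lie_sub, ← lie_skew W3 W1, ← lie_skew Z1 W1, h3, h4, h9, h11]
    module
  have b35 : ⁅u3, u5⁆ = 0 := by
    rw [hu3, hu5]
    simp only [add_lie, lie_sub, lie_self, ← lie_skew Z1 W3, h15]
    module
  have e1 : π ⁅X, x1 • u1⁆ = -(x1 • ((1 - √13 / 2) • (x2 • u3 - x3 • u2)
      + (1 + √13 / 2) • (x5 • u4 - x4 • u5))) := by
    rw [hX]
    simp only [add_lie, lie_smul, smul_lie, lie_self, ← lie_skew u2 u1, ← lie_skew u3 u1,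
      ← lie_skew u4 u1, ← lie_skew u5 u1, b12, b13, b14, b15, map_add, map_smul, map_neg, map_zero,
      hπ2, hπ3, hπ4, hπ5]
    module
  have e2 : π ⁅X, x2 • u2 + x3 • u3⁆ = x1 • (1 - √13 / 2) • (x2 • u3 - x3 • u2) := by
    rw [hX]
    simp only [add_lie, lie_add, lie_smul, smul_lie, lie_self, ← lie_skew u3 u2, ← lie_skew u4 u2,
      ← lie_skew u5 u2, ← lie_skew u4 u3, ← lie_skew u5 u3, b12, b13, b24, b25, b34, b35, map_add,
      map_smul, map_neg, map_zero, hπ2, hπ3]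
    module
  have e3 : π ⁅X, x4 • u4 + x5 • u5⁆ = x1 • (1 + √13 / 2) • (x5 • u4 - x4 • u5) := by
    rw [hX]
    simp only [add_lie, lie_add, lie_smul, smul_lie, lie_self, ← lie_skew u5 u4, b14, b15, b24, b25,
      b34, b35, map_add, map_smul, map_neg, map_zero, hπ4, hπ5]
    module
  rw [e1, e2, e3]
  constructor
  · rintro ⟨-, h23, h45⟩
    refine or_iff_not_imp_left.2 fun hx1 ↦ ?_
    have hs : 1 - √13 / 2 ≠ 0 := by
      intro h
      nlinarith [Real.sq_sqrt (show (0 : ℝ) ≤ 13 by norm_num)]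
    have ht : 1 + √13 / 2 ≠ 0 := by positivity
    replace h23 := (smul_eq_zero_iff_right hs).1 ((smul_eq_zero_iff_right hx1).1 h23)
    replace h45 := (smul_eq_zero_iff_right ht).1 ((smul_eq_zero_iff_right hx1).1 h45)
    have li := Fintype.linearIndependent_iff.1 hindep
    have c23 := li ![-x3, 0, x2, x2, 0, -x3] (by
      rw [← h23, hu2, hu3]
      simp [Fin.sum_univ_succ]
      module)
    have c45 := li ![x5, 0, -x4, x4, 0, -x5] (by
      rw [← h45, hu4, hu5]
      simp [Fin.sum_univ_succ]
      module)
    exact ⟨c23 2, neg_eq_zero.1 (c23 0), c45 3, c45 0⟩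
  · rintro (rfl | ⟨rfl, rfl, rfl, rfl⟩) <;> simp
end

section
/- Let α = √13 − 2, β = √13 + 2, and let P = (P¹, P², P³) with P¹ = x(−x²/2 + x/α − y²/4), P² = y(−x²/4 + y/β − y²/2), P³ = −z(x²+y²)/4 in ℝ[x,y,z]. Suppose f ∈ ℝ[x,y,z] has total degree 2 and there exists k ∈ ℝ[x,y,z] of total degree at most 2 such that P¹·∂f/∂x + P²·∂f/∂y + P³·∂f/∂z = k·f. Then f is a nonzero scalar multiple of one of the six monomials x², y², z², xy, xz, yz. -/
noncomputable section

open MvPolynomial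

/-- First component of the time-rescaled homogeneous Ricci flow system. -/
def P1 : MvPolynomial (Fin 3) ℝ :=
  X 0 * (C ((-1 : ℝ) / 2) * X 0 ^ 2 + C (1 / (Real.sqrt 13 - 2)) * X 0 +
    C ((-1 : ℝ) / 4) * X 1 ^ 2)

/-- Second component of the time-rescaled homogeneous Ricci flow system. -/
def P2 : MvPolynomial (Fin 3) ℝ :=
  X 1 * (C ((-1 : ℝ) / 4) * X 0 ^ 2 + C (1 / (Real.sqrt 13 + 2)) * X 1 +
    C ((-1 : ℝ) / 2) * X 1 ^ 2)

/-- Third component of the time-rescaled homogeneous Ricci flow system. -/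
def P3 : MvPolynomial (Fin 3) ℝ :=
  C ((-1 : ℝ) / 4) * X 2 * (X 0 ^ 2 + X 1 ^ 2)

/-- `f` is a Darboux polynomial of the system with cofactor `k`. -/
def IsDarboux (f k : MvPolynomial (Fin 3) ℝ) : Prop :=
  P1 * pderiv 0 f + P2 * pderiv 1 f + P3 * pderiv 2 f = k * f

/-- The quadratic polynomial with coefficients `p` with respect to the monomials
`1, x, y, z, x², y², z², xy, xz, yz`, in this order. -/
def quadratic (p : Fin 10 → ℝ) : MvPolynomial (Fin 3) ℝ :=
  C (p 0) + C (p 1) * X 0 + C (p 2) * X 1 + C (p 3) * X 2 + C (p 4) * X 0 ^ 2 +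
    C (p 5) * X 1 ^ 2 + C (p 6) * X 2 ^ 2 + C (p 7) * (X 0 * X 1) + C (p 8) * (X 0 * X 2) +
    C (p 9) * (X 1 * X 2)

lemma quadratic_add (p q : Fin 10 → ℝ) : quadratic (p + q) = quadratic p + quadratic q := by
  simp only [quadratic, Pi.add_apply, C_add]
  ring

lemma eval_quadratic (p : Fin 10 → ℝ) (x y z : ℝ) :
    eval ![x, y, z] (quadratic p) = p 0 + p 1 * x + p 2 * y + p 3 * z + p 4 * x ^ 2 +
      p 5 * y ^ 2 + p 6 * z ^ 2 + p 7 * (x * y) + p 8 * (x * z) + p 9 * (y * z) := by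
  simp [quadratic]

lemma eval_pderiv_zero_quadratic (p : Fin 10 → ℝ) (x y z : ℝ) :
    eval ![x, y, z] (pderiv 0 (quadratic p)) = p 1 + 2 * p 4 * x + p 7 * y + p 8 * z := by
  simp [quadratic, pderiv_X]
  ring

lemma eval_pderiv_one_quadratic (p : Fin 10 → ℝ) (x y z : ℝ) :
    eval ![x, y, z] (pderiv 1 (quadratic p)) = p 2 + 2 * p 5 * y + p 7 * x + p 9 * z := by
  simp [quadratic, pderiv_X]
  ring

lemma eval_pderiv_two_quadratic (p : Fin 10 → ℝ) (x y z : ℝ) :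
    eval ![x, y, z] (pderiv 2 (quadratic p)) = p 3 + 2 * p 6 * z + p 8 * x + p 9 * y := by
  simp [quadratic, pderiv_X]
  ring

lemma exists_monomial_eq_quadratic (s : Fin 3 →₀ ℕ) (c : ℝ) (hs : s.degree ≤ 2) :
    ∃ p, monomial s c = quadratic p := by
  rw [monomial_eq, Finsupp.prod_fintype _ _ (by simp), Fin.prod_univ_three]
  rw [Finsupp.degree_eq_sum, Fin.sum_univ_three] at hs
  generalize s 0 = i at *
  generalize s 1 = j at *
  generalize s 2 = l at *
  have hi : i ≤ 2 := by omega
  have hj : j ≤ 2 := by omega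
  have hl : l ≤ 2 := by omega
  refine ⟨![if (i, j, l) = (0, 0, 0) then c else 0, if (i, j, l) = (1, 0, 0) then c else 0,
    if (i, j, l) = (0, 1, 0) then c else 0, if (i, j, l) = (0, 0, 1) then c else 0,
    if (i, j, l) = (2, 0, 0) then c else 0, if (i, j, l) = (0, 2, 0) then c else 0,
    if (i, j, l) = (0, 0, 2) then c else 0, if (i, j, l) = (1, 1, 0) then c else 0,
    if (i, j, l) = (1, 0, 1) then c else 0, if (i, j, l) = (0, 1, 1) then c else 0], ?_⟩
  interval_cases i <;> interval_cases j <;> interval_cases l <;>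
    first | omega | simp [quadratic]

lemma exists_eq_quadratic_of_totalDegree_le (f : MvPolynomial (Fin 3) ℝ)
    (hf : f.totalDegree ≤ 2) : ∃ p, f = quadratic p := by
  rw [f.as_sum]
  refine Finset.sum_induction _ (fun g => ∃ p, g = quadratic p) ?_ ⟨0, by simp [quadratic]⟩
    fun s hs => exists_monomial_eq_quadratic s _ ?_
  · rintro _ _ ⟨p, rfl⟩ ⟨q, rfl⟩
    exact ⟨p + q, (quadratic_add p q).symm⟩
  · exact (le_totalDegree hs).trans hf

lemma totalDegree_quadratic_le_one (p : Fin 10 → ℝ) (hp : ∀ i, 4 ≤ i → p i = 0) :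
    (quadratic p).totalDegree ≤ 1 := by
  have h (c : ℝ) (i : Fin 3) : (C c * X i : MvPolynomial (Fin 3) ℝ).totalDegree ≤ 1 :=
    (totalDegree_mul _ _).trans (by simp)
  simp only [quadratic, hp 4 (by decide), hp 5 (by decide), hp 6 (by decide), hp 7 (by decide),
    hp 8 (by decide), hp 9 (by decide), C_0, zero_mul, add_zero]
  refine (totalDegree_add _ _).trans (max_le ((totalDegree_add _ _).trans
    (max_le ((totalDegree_add _ _).trans (max_le ?_ (h _ _))) (h _ _))) (h _ _))
  simp

lemma coeff_eq_zero_of_forall_sum_eq_zero {n : ℕ} (c : ℕ → ℝ)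
    (h : ∀ t : ℝ, ∑ i ∈ Finset.range n, c i * t ^ i = 0) {i : ℕ} (hi : i < n) : c i = 0 := by
  have hP : ∑ i ∈ Finset.range n, Polynomial.C (c i) * Polynomial.X ^ i = 0 :=
    Polynomial.funext fun t => by simpa [Polynomial.eval_finsetSum] using h t
  simpa [Polynomial.finsetSum_coeff, Polynomial.coeff_C_mul, Polynomial.coeff_X_pow, hi]
    using congrArg (Polynomial.coeff · i) hP

lemma coeff_eq_zero_of_forall_sum_eq_zero₃ {n : ℕ} (c : ℕ → ℕ → ℕ → ℝ)
    (h : ∀ x y z : ℝ, ∑ l ∈ Finset.range n, (∑ j ∈ Finset.range (n - l),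
      (∑ i ∈ Finset.range (n - l - j), c i j l * x ^ i) * y ^ j) * z ^ l = 0)
    {i j l : ℕ} (hijl : i + j + l < n) : c i j l = 0 :=
  coeff_eq_zero_of_forall_sum_eq_zero (n := n - l - j) _ (fun x =>
    coeff_eq_zero_of_forall_sum_eq_zero (n := n - l) _ (fun y =>
      coeff_eq_zero_of_forall_sum_eq_zero (n := n) _ (fun z => h x y z) (i := l) (by omega))
      (i := j) (by omega)) (by omega)

/-- The coefficient of `xⁱ yʲ zˡ` in `k f - ∇f · P`, for the quadratic polynomials `f` and `k` with
coefficients `p` and `k` and the Ricci flow field `P` with quadratic part `(a x², b y², 0)`. -/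
def darbouxCoeff (a b : ℝ) (p k : Fin 10 → ℝ) : ℕ → ℕ → ℕ → ℝ
  | 0, 0, 4 => k 6 * p 6
  | 0, 1, 3 => k 9 * p 6 + k 6 * p 9
  | 0, 2, 2 => k 6 * p 5 + k 5 * p 6 + 1 / 2 * p 6 + k 9 * p 9
  | 0, 3, 1 => k 9 * p 5 + k 5 * p 9 + 3 / 4 * p 9
  | 0, 4, 0 => k 5 * p 5 + p 5
  | 1, 0, 3 => k 8 * p 6 + k 6 * p 8
  | 1, 1, 2 => k 7 * p 6 + k 6 * p 7 + k 9 * p 8 + k 8 * p 9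
  | 1, 2, 1 => k 8 * p 5 + k 9 * p 7 + k 5 * p 8 + 1 / 2 * p 8 + k 7 * p 9
  | 1, 3, 0 => k 7 * p 5 + k 5 * p 7 + 3 / 4 * p 7
  | 2, 0, 2 => k 6 * p 4 + k 4 * p 6 + 1 / 2 * p 6 + k 8 * p 8
  | 2, 1, 1 => k 9 * p 4 + k 8 * p 7 + k 7 * p 8 + k 4 * p 9 + 1 / 2 * p 9
  | 2, 2, 0 => k 5 * p 4 + 1 / 2 * p 4 + k 4 * p 5 + 1 / 2 * p 5 + k 7 * p 7
  | 3, 0, 1 => k 8 * p 4 + k 4 * p 8 + 3 / 4 * p 8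
  | 3, 1, 0 => k 7 * p 4 + k 4 * p 7 + 3 / 4 * p 7
  | 4, 0, 0 => k 4 * p 4 + p 4
  | 0, 0, 3 => k 6 * p 3 + k 3 * p 6
  | 0, 1, 2 => k 6 * p 2 + k 9 * p 3 + k 2 * p 6 + k 3 * p 9
  | 0, 2, 1 => k 9 * p 2 + k 5 * p 3 + 1 / 4 * p 3 + k 3 * p 5 + k 2 * p 9 - b * p 9
  | 0, 3, 0 => k 5 * p 2 + 1 / 2 * p 2 + k 2 * p 5 - 2 * b * p 5
  | 1, 0, 2 => k 6 * p 1 + k 8 * p 3 + k 1 * p 6 + k 3 * p 8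
  | 1, 1, 1 => k 9 * p 1 + k 8 * p 2 + k 7 * p 3 + k 3 * p 7 + k 2 * p 8 + k 1 * p 9
  | 1, 2, 0 => k 5 * p 1 + 1 / 4 * p 1 + k 7 * p 2 + k 1 * p 5 + k 2 * p 7 - b * p 7
  | 2, 0, 1 => k 8 * p 1 + k 4 * p 3 + 1 / 4 * p 3 + k 3 * p 4 + k 1 * p 8 - a * p 8
  | 2, 1, 0 => k 7 * p 1 + k 4 * p 2 + 1 / 4 * p 2 + k 2 * p 4 + k 1 * p 7 - a * p 7
  | 3, 0, 0 => k 4 * p 1 + 1 / 2 * p 1 + k 1 * p 4 - 2 * a * p 4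
  | 0, 0, 2 => k 6 * p 0 + k 3 * p 3 + k 0 * p 6
  | 0, 1, 1 => k 9 * p 0 + k 3 * p 2 + k 2 * p 3 + k 0 * p 9
  | 0, 2, 0 => k 5 * p 0 + k 2 * p 2 - b * p 2 + k 0 * p 5
  | 1, 0, 1 => k 8 * p 0 + k 3 * p 1 + k 1 * p 3 + k 0 * p 8
  | 1, 1, 0 => k 7 * p 0 + k 2 * p 1 + k 1 * p 2 + k 0 * p 7
  | 2, 0, 0 => k 4 * p 0 + k 1 * p 1 - a * p 1 + k 0 * p 4
  | 0, 0, 1 => k 3 * p 0 + k 0 * p 3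
  | 0, 1, 0 => k 2 * p 0 + k 0 * p 2
  | 1, 0, 0 => k 1 * p 0 + k 0 * p 1
  | 0, 0, 0 => k 0 * p 0
  | _, _, _ => 0

set_option maxHeartbeats 1000000 in
lemma darbouxCoeff_eq_zero (p k : Fin 10 → ℝ) (h : IsDarboux (quadratic p) (quadratic k))
    (i j l : ℕ) (hijl : i + j + l < 5) :
    darbouxCoeff (1 / (Real.sqrt 13 - 2)) (1 / (Real.sqrt 13 + 2)) p k i j l = 0 := by
  refine coeff_eq_zero_of_forall_sum_eq_zero₃ _ (fun x y z => ?_) hijl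
  have h' := congrArg (eval ![x, y, z]) h
  simp only [map_add, map_mul, eval_pderiv_zero_quadratic, eval_pderiv_one_quadratic,
    eval_pderiv_two_quadratic, eval_quadratic, P1, P2, P3, map_pow, eval_X, eval_C,
    Matrix.cons_val] at h'
  simp only [Finset.sum_range_succ, Finset.sum_range_zero, Nat.reduceSub, darbouxCoeff]
  linear_combination -h'

/-! The following lemmas solve the equations `darbouxCoeff a b p k i j l = 0`, which are named
after their exponents `i j l`, case by case. -/

lemma coeff_eq_zero_of_zz_ne_zero
    {a b p0 p1 p2 p3 p4 p5 p6 p7 p8 p9 k0 k1 k2 k3 k4 k5 k6 k7 k8 k9 : ℝ} (hp : p6 ≠ 0)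
    (e004 : k6 * p6 = 0) (e013 : k9 * p6 + k6 * p9 = 0) (e103 : k8 * p6 + k6 * p8 = 0)
    (e022 : k6 * p5 + p6 / 2 + k5 * p6 + k9 * p9 = 0)
    (e202 : k6 * p4 + p6 / 2 + k4 * p6 + k8 * p8 = 0)
    (e112 : k7 * p6 + k6 * p7 + k9 * p8 + k8 * p9 = 0)
    (e031 : k9 * p5 + 3 / 4 * p9 + k5 * p9 = 0) (e301 : k8 * p4 + 3 / 4 * p8 + k4 * p8 = 0)
    (e040 : p5 + k5 * p5 = 0) (e400 : p4 + k4 * p4 = 0)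
    (e130 : k7 * p5 + 3 / 4 * p7 + k5 * p7 = 0) (e003 : k6 * p3 + k3 * p6 = 0)
    (e012 : k6 * p2 + k9 * p3 + k2 * p6 + k3 * p9 = 0)
    (e102 : k6 * p1 + k8 * p3 + k1 * p6 + k3 * p8 = 0)
    (e021 : k9 * p2 + p3 / 4 + k5 * p3 + k3 * p5 - b * p9 + k2 * p9 = 0)
    (e210 : k7 * p1 + p2 / 4 + k4 * p2 + k2 * p4 - a * p7 + k1 * p7 = 0)
    (e120 : p1 / 4 + k5 * p1 + k7 * p2 + k1 * p5 - b * p7 + k2 * p7 = 0)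
    (e002 : k6 * p0 + k3 * p3 + k0 * p6 = 0) (e020 : k5 * p0 - b * p2 + k2 * p2 + k0 * p5 = 0) :
    p0 = 0 ∧ p1 = 0 ∧ p2 = 0 ∧ p3 = 0 ∧ p4 = 0 ∧ p5 = 0 ∧ p7 = 0 ∧ p8 = 0 ∧ p9 = 0 := by
  obtain rfl : k6 = 0 := by grind
  obtain rfl : k9 = 0 := by grind
  obtain rfl : k8 = 0 := by grind
  obtain rfl : k5 = -1 / 2 := by grind
  obtain rfl : k4 = -1 / 2 := by grind
  grind

lemma false_of_xz_ne_zero_of_yz_ne_zero {a b p3 p8 p9 k0 k1 k2 k4 k5 k7 : ℝ} (ha : a ≠ b)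
    (ha' : a + b ≠ 0) (h8 : p8 ≠ 0) (h9 : p9 ≠ 0) (e031 : 3 / 4 * p9 + k5 * p9 = 0)
    (e301 : 3 / 4 * p8 + k4 * p8 = 0) (e121 : p8 / 2 + k5 * p8 + k7 * p9 = 0)
    (e211 : k7 * p8 + p9 / 2 + k4 * p9 = 0) (e021 : p3 / 4 + k5 * p3 - b * p9 + k2 * p9 = 0)
    (e201 : p3 / 4 + k4 * p3 - a * p8 + k1 * p8 = 0) (e111 : k7 * p3 + k2 * p8 + k1 * p9 = 0)
    (e011 : k2 * p3 + k0 * p9 = 0) (e101 : k1 * p3 + k0 * p8 = 0) :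
    False := by
  obtain rfl : k5 = -3 / 4 := by grind
  obtain rfl : k4 = -3 / 4 := by grind
  have : k7 = 1 / 4 ∨ k7 = -1 / 4 := by grind
  rcases this with rfl | rfl <;> grind

lemma planar_coeff_alternatives {a b p0 p1 p2 p4 p5 p7 k0 k1 k2 k4 k5 k7 : ℝ} (ha0 : 0 < b)
    (ha : b < a) (e040 : p5 + k5 * p5 = 0) (e400 : p4 + k4 * p4 = 0)
    (e130 : k7 * p5 + 3 / 4 * p7 + k5 * p7 = 0) (e310 : k7 * p4 + 3 / 4 * p7 + k4 * p7 = 0)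
    (e220 : p4 / 2 + k5 * p4 + p5 / 2 + k4 * p5 + k7 * p7 = 0)
    (e210 : k7 * p1 + p2 / 4 + k4 * p2 + k2 * p4 - a * p7 + k1 * p7 = 0)
    (e120 : p1 / 4 + k5 * p1 + k7 * p2 + k1 * p5 - b * p7 + k2 * p7 = 0)
    (e030 : p2 / 2 + k5 * p2 - 2 * b * p5 + k2 * p5 = 0)
    (e300 : p1 / 2 + k4 * p1 - 2 * a * p4 + k1 * p4 = 0)
    (e020 : k5 * p0 - b * p2 + k2 * p2 + k0 * p5 = 0)
    (e200 : k4 * p0 - a * p1 + k1 * p1 + k0 * p4 = 0)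
    (e110 : k7 * p0 + k2 * p1 + k1 * p2 + k0 * p7 = 0) (e010 : k2 * p0 + k0 * p2 = 0)
    (e100 : k1 * p0 + k0 * p1 = 0) (e000 : k0 * p0 = 0) :
    (p4 = 0 ∧ p5 = 0 ∧ p7 = 0) ∨ (p0 = 0 ∧ p1 = 0 ∧ p2 = 0 ∧ ((p4 = 0 ∧ p5 = 0) ∨ (p4 = 0 ∧ p7 =
      0) ∨ (p5 = 0 ∧ p7 = 0))) := by
  have hab : a + b ≠ 0 := by linarith
  have hab' : a - b ≠ 0 := by linarith
  have hb : b ≠ 0 := by linarith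
  have hA : a ≠ 0 := by linarith
  clear ha0 ha
  by_cases h4 : p4 = 0
  · subst h4
    by_cases h5 : p5 = 0
    · subst h5
      by_cases h7 : p7 = 0
      · grind
      · have : k5 = -3 / 4 := by grind
        have : k4 = -3 / 4 := by grind
        have : k7 = 0 := by grind
        grind
    · obtain rfl : k5 = -1 := by grind
      by_cases h7 : p7 = 0
      · grind
      · obtain rfl : k4 = -3 / 4 := by grind
        exfalso
        grind
  · obtain rfl : k4 = -1 := by grind
    by_cases h5 : p5 = 0
    · subst h5
      by_cases h7 : p7 = 0
      · grind
      · obtain rfl : k5 = -3 / 4 := by grind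
        exfalso
        grind
    · obtain rfl : k5 = -1 := by grind
      exfalso
      by_cases h7 : k7 = 0
      · subst h7
        obtain rfl : p7 = 0 := by grind
        obtain rfl : p5 = -p4 := by grind
        obtain rfl : k0 = 0 := by grind
        grind
      · have : k7 = 1 / 2 ∨ k7 = -1 / 2 := by grind
        rcases this with rfl | rfl
        · obtain rfl : p5 = p4 := by grind
          obtain rfl : p7 = 2 * p5 := by grind
          grind
        · obtain rfl : p5 = p4 := by grind
          obtain rfl : p7 = -2 * p5 := by grind
          grind

lemma coeff_eq_zero_of_xz_ne_zero {a b p0 p1 p2 p3 p4 p5 p7 p8 k0 k1 k2 k4 k5 k7 : ℝ}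
    (h8 : p8 ≠ 0) (e301 : 3 / 4 * p8 + k4 * p8 = 0) (e121 : p8 / 2 + k5 * p8 = 0)
    (e211 : k7 * p8 = 0) (e021 : p3 / 4 + k5 * p3 = 0) (e111 : k7 * p3 + k2 * p8 = 0)
    (e040 : p5 + k5 * p5 = 0) (e400 : p4 + k4 * p4 = 0)
    (e130 : k7 * p5 + 3 / 4 * p7 + k5 * p7 = 0)
    (e210 : k7 * p1 + p2 / 4 + k4 * p2 + k2 * p4 - a * p7 + k1 * p7 = 0)
    (e300 : p1 / 2 + k4 * p1 - 2 * a * p4 + k1 * p4 = 0)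
    (e020 : k5 * p0 - b * p2 + k2 * p2 + k0 * p5 = 0) :
    p0 = 0 ∧ p1 = 0 ∧ p2 = 0 ∧ p3 = 0 ∧ p4 = 0 ∧ p5 = 0 ∧ p7 = 0 := by
  grind

lemma planar_quadratic_eq_zero_of_z_ne_zero {p3 p4 p5 p7 k4 k5 k7 : ℝ}
    (e021 : p3 / 4 + k5 * p3 = 0) (e201 : p3 / 4 + k4 * p3 = 0) (e111 : k7 * p3 = 0)
    (e040 : p5 + k5 * p5 = 0) (e400 : p4 + k4 * p4 = 0)
    (e130 : k7 * p5 + 3 / 4 * p7 + k5 * p7 = 0) (h : p3 ≠ 0) :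
    p4 = 0 ∧ p5 = 0 ∧ p7 = 0 := by
  obtain rfl : k4 = -1 / 4 := by grind
  exact ⟨by linear_combination 4 / 3 * e400, by grind⟩

lemma cofactor_z_coeff_eq_zero {p0 p1 p2 p3 p4 p5 p7 p8 p9 a b k1 k2 k3 k4 k5 k6 k7 k8 k9 : ℝ}
    (hp : p4 ≠ 0 ∨ p5 ≠ 0 ∨ p7 ≠ 0 ∨ p8 ≠ 0 ∨ p9 ≠ 0) (e013 : k6 * p9 = 0) (e103 : k6 * p8 = 0)
    (e022 : k6 * p5 + k9 * p9 = 0) (e202 : k6 * p4 + k8 * p8 = 0)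
    (e112 : k6 * p7 + k9 * p8 + k8 * p9 = 0) (e031 : k9 * p5 + 3 / 4 * p9 + k5 * p9 = 0)
    (e301 : k8 * p4 + 3 / 4 * p8 + k4 * p8 = 0)
    (e121 : k8 * p5 + k9 * p7 + p8 / 2 + k5 * p8 + k7 * p9 = 0)
    (e211 : k9 * p4 + k8 * p7 + k7 * p8 + p9 / 2 + k4 * p9 = 0) (e040 : p5 + k5 * p5 = 0)
    (e130 : k7 * p5 + 3 / 4 * p7 + k5 * p7 = 0) (e003 : k6 * p3 = 0)
    (e012 : k6 * p2 + k9 * p3 + k3 * p9 = 0) (e102 : k6 * p1 + k8 * p3 + k3 * p8 = 0)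
    (e021 : k9 * p2 + p3 / 4 + k5 * p3 + k3 * p5 = b * p9 - k2 * p9)
    (e201 : k8 * p1 + p3 / 4 + k4 * p3 + k3 * p4 = a * p8 - k1 * p8)
    (e111 : k9 * p1 + k8 * p2 + k7 * p3 + k3 * p7 + k2 * p8 + k1 * p9 = 0)
    (e002 : k6 * p0 + k3 * p3 = 0) :
    k6 = 0 ∧ k8 = 0 ∧ k9 = 0 ∧ k3 = 0 := by
  obtain rfl : k6 = 0 := by grind
  obtain ⟨rfl, rfl⟩ : k8 = 0 ∧ k9 = 0 := by
    by_cases h8 : p8 = 0 <;> by_cases h9 : p9 = 0 <;> grind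
  by_cases h8 : p8 = 0 <;> by_cases h9 : p9 = 0
  · by_cases h3 : p3 = 0 <;> grind
  all_goals grind

lemma exists_forall_ne_coeff_eq_zero {a b : ℝ} {p k : Fin 10 → ℝ} (hb : 0 < b) (hab : b < a)
    (h : ∀ i j l : ℕ, i + j + l < 5 → darbouxCoeff a b p k i j l = 0)
    (hp : ∃ i, 4 ≤ i ∧ p i ≠ 0) : ∃ i, 4 ≤ i ∧ ∀ j, j ≠ i → p j = 0 := by
  have e004 : k 6 * p 6 = 0 := h 0 0 4 (by decide)
  have e013 : k 9 * p 6 + k 6 * p 9 = 0 := h 0 1 3 (by decide)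
  have e022 : k 6 * p 5 + k 5 * p 6 + 1 / 2 * p 6 + k 9 * p 9 = 0 := h 0 2 2 (by decide)
  have e031 : k 9 * p 5 + k 5 * p 9 + 3 / 4 * p 9 = 0 := h 0 3 1 (by decide)
  have e040 : k 5 * p 5 + p 5 = 0 := h 0 4 0 (by decide)
  have e103 : k 8 * p 6 + k 6 * p 8 = 0 := h 1 0 3 (by decide)
  have e112 : k 7 * p 6 + k 6 * p 7 + k 9 * p 8 + k 8 * p 9 = 0 := h 1 1 2 (by decide)
  have e121 : k 8 * p 5 + k 9 * p 7 + k 5 * p 8 + 1 / 2 * p 8 + k 7 * p 9 = 0 := h 1 2 1 (by decide)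
  have e130 : k 7 * p 5 + k 5 * p 7 + 3 / 4 * p 7 = 0 := h 1 3 0 (by decide)
  have e202 : k 6 * p 4 + k 4 * p 6 + 1 / 2 * p 6 + k 8 * p 8 = 0 := h 2 0 2 (by decide)
  have e211 : k 9 * p 4 + k 8 * p 7 + k 7 * p 8 + k 4 * p 9 + 1 / 2 * p 9 = 0 := h 2 1 1 (by decide)
  have e220 : k 5 * p 4 + 1 / 2 * p 4 + k 4 * p 5 + 1 / 2 * p 5 + k 7 * p 7 = 0 :=
    h 2 2 0 (by decide)
  have e301 : k 8 * p 4 + k 4 * p 8 + 3 / 4 * p 8 = 0 := h 3 0 1 (by decide)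
  have e310 : k 7 * p 4 + k 4 * p 7 + 3 / 4 * p 7 = 0 := h 3 1 0 (by decide)
  have e400 : k 4 * p 4 + p 4 = 0 := h 4 0 0 (by decide)
  have e003 : k 6 * p 3 + k 3 * p 6 = 0 := h 0 0 3 (by decide)
  have e012 : k 6 * p 2 + k 9 * p 3 + k 2 * p 6 + k 3 * p 9 = 0 := h 0 1 2 (by decide)
  have e021 : k 9 * p 2 + k 5 * p 3 + 1 / 4 * p 3 + k 3 * p 5 + k 2 * p 9 - b * p 9 = 0 :=
    h 0 2 1 (by decide)
  have e030 : k 5 * p 2 + 1 / 2 * p 2 + k 2 * p 5 - 2 * b * p 5 = 0 := h 0 3 0 (by decide)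
  have e102 : k 6 * p 1 + k 8 * p 3 + k 1 * p 6 + k 3 * p 8 = 0 := h 1 0 2 (by decide)
  have e111 : k 9 * p 1 + k 8 * p 2 + k 7 * p 3 + k 3 * p 7 + k 2 * p 8 + k 1 * p 9 = 0 :=
    h 1 1 1 (by decide)
  have e120 : k 5 * p 1 + 1 / 4 * p 1 + k 7 * p 2 + k 1 * p 5 + k 2 * p 7 - b * p 7 = 0 :=
    h 1 2 0 (by decide)
  have e201 : k 8 * p 1 + k 4 * p 3 + 1 / 4 * p 3 + k 3 * p 4 + k 1 * p 8 - a * p 8 = 0 :=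
    h 2 0 1 (by decide)
  have e210 : k 7 * p 1 + k 4 * p 2 + 1 / 4 * p 2 + k 2 * p 4 + k 1 * p 7 - a * p 7 = 0 :=
    h 2 1 0 (by decide)
  have e300 : k 4 * p 1 + 1 / 2 * p 1 + k 1 * p 4 - 2 * a * p 4 = 0 := h 3 0 0 (by decide)
  have e002 : k 6 * p 0 + k 3 * p 3 + k 0 * p 6 = 0 := h 0 0 2 (by decide)
  have e011 : k 9 * p 0 + k 3 * p 2 + k 2 * p 3 + k 0 * p 9 = 0 := h 0 1 1 (by decide)
  have e020 : k 5 * p 0 + k 2 * p 2 - b * p 2 + k 0 * p 5 = 0 := h 0 2 0 (by decide)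
  have e101 : k 8 * p 0 + k 3 * p 1 + k 1 * p 3 + k 0 * p 8 = 0 := h 1 0 1 (by decide)
  have e110 : k 7 * p 0 + k 2 * p 1 + k 1 * p 2 + k 0 * p 7 = 0 := h 1 1 0 (by decide)
  have e200 : k 4 * p 0 + k 1 * p 1 - a * p 1 + k 0 * p 4 = 0 := h 2 0 0 (by decide)
  have e010 : k 2 * p 0 + k 0 * p 2 = 0 := h 0 1 0 (by decide)
  have e100 : k 1 * p 0 + k 0 * p 1 = 0 := h 1 0 0 (by decide)
  have e000 : k 0 * p 0 = 0 := h 0 0 0 (by decide)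
  by_cases hp6 : p 6 = 0
  · have hp' : p 4 ≠ 0 ∨ p 5 ≠ 0 ∨ p 7 ≠ 0 ∨ p 8 ≠ 0 ∨ p 9 ≠ 0 := by
      obtain ⟨i, hi, hpi⟩ := hp
      fin_cases i <;> simp_all
    simp only [hp6, mul_zero, zero_add, add_zero]
      at e013 e103 e022 e202 e112 e003 e012 e102 e002
    obtain ⟨-, hk8, hk9, hk3⟩ := cofactor_z_coeff_eq_zero (a := a) (b := b)
      (p0 := p 0) (p1 := p 1) (p2 := p 2) (p3 := p 3) (p4 := p 4) (p5 := p 5) (p7 := p 7)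
      (p8 := p 8) (p9 := p 9) (k1 := k 1) (k2 := k 2) (k3 := k 3) (k4 := k 4) (k5 := k 5)
      (k6 := k 6) (k7 := k 7) (k8 := k 8) (k9 := k 9) hp'
      e013 e103 e022 e202 e112 (by linear_combination e031) (by linear_combination e301)
      (by linear_combination e121) (by linear_combination e211) (by linear_combination e040)
      (by linear_combination e130) e003 e012 e102
      (by linear_combination e021) (by linear_combination e201) e111 e002
    simp only [hk8, hk9, hk3, zero_mul, zero_add, add_zero]
      at e031 e121 e211 e301 e021 e111 e201 e011 e101
    by_cases hp8 : p 8 = 0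
    · by_cases hp9 : p 9 = 0
      · simp only [hp8, hp9, mul_zero, sub_zero, add_zero] at e021 e201 e111
        have hp3 : p 3 = 0 := by
          by_contra hp3
          have := planar_quadratic_eq_zero_of_z_ne_zero (p3 := p 3)
            (p4 := p 4) (p5 := p 5) (p7 := p 7) (k4 := k 4) (k5 := k 5) (k7 := k 7)
            (by linear_combination e021) (by linear_combination e201) e111
            (by linear_combination e040) (by linear_combination e400)
            (by linear_combination e130) hp3
          tauto
        rcases planar_coeff_alternatives
          (p0 := p 0) (p1 := p 1) (p2 := p 2) (p4 := p 4) (p5 := p 5) (p7 := p 7) (k0 := k 0)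
          (k1 := k 1) (k2 := k 2) (k4 := k 4) (k5 := k 5) (k7 := k 7)
          hb hab (by linear_combination e040)
          (by linear_combination e400) (by linear_combination e130) (by linear_combination e310)
          (by linear_combination e220) (by linear_combination e210) (by linear_combination e120)
          (by linear_combination e030) (by linear_combination e300) (by linear_combination e020)
          (by linear_combination e200) e110 e010 e100 e000 with
          ⟨h4, h5, h7⟩ | ⟨h0, h1, h2, ⟨h4, h5⟩ | ⟨h4, h7⟩ | ⟨h5, h7⟩⟩
        · tauto
        · exact ⟨7, by decide, fun j hj => by
            fin_cases j <;> first | assumption | exact absurd rfl hj⟩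
        · exact ⟨5, by decide, fun j hj => by
            fin_cases j <;> first | assumption | exact absurd rfl hj⟩
        · exact ⟨4, by decide, fun j hj => by
            fin_cases j <;> first | assumption | exact absurd rfl hj⟩
      · simp only [hp8, mul_zero, sub_zero, zero_add, add_zero] at e121 e211 e201 e111
        obtain ⟨h0, h1, h2, h3, h4, h5, h7⟩ := coeff_eq_zero_of_xz_ne_zero (a := b) (b := a)
          (p0 := p 0) (p1 := p 2) (p2 := p 1) (p3 := p 3) (p4 := p 5) (p5 := p 4) (p7 := p 7)
          (p8 := p 9) (k0 := k 0) (k1 := k 2) (k2 := k 1) (k4 := k 5) (k5 := k 4) (k7 := k 7) hp9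
          (by linear_combination e031) (by linear_combination e211) e121
          (by linear_combination e201) e111 (by linear_combination e400)
          (by linear_combination e040) (by linear_combination e310) (by linear_combination e120)
          (by linear_combination e030) (by linear_combination e200)
        exact ⟨9, by decide, fun j hj => by
          fin_cases j <;> first | assumption | exact absurd rfl hj⟩
    · by_cases hp9 : p 9 = 0
      · simp only [hp9, mul_zero, sub_zero, add_zero] at e121 e211 e021 e111
        obtain ⟨h0, h1, h2, h3, h4, h5, h7⟩ := coeff_eq_zero_of_xz_ne_zero (a := a) (b := b)
          (p0 := p 0) (p1 := p 1) (p2 := p 2) (p3 := p 3) (p4 := p 4) (p5 := p 5) (p7 := p 7)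
          (p8 := p 8) (k0 := k 0) (k1 := k 1) (k2 := k 2) (k4 := k 4) (k5 := k 5) (k7 := k 7) hp8
          (by linear_combination e301) (by linear_combination e121) e211
          (by linear_combination e021) e111 (by linear_combination e040)
          (by linear_combination e400) (by linear_combination e130) (by linear_combination e210)
          (by linear_combination e300) (by linear_combination e020)
        exact ⟨8, by decide, fun j hj => by
          fin_cases j <;> first | assumption | exact absurd rfl hj⟩
      · exact (false_of_xz_ne_zero_of_yz_ne_zero
          (p3 := p 3) (p8 := p 8) (p9 := p 9) (k0 := k 0) (k1 := k 1) (k2 := k 2) (k4 := k 4)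
          (k5 := k 5) (k7 := k 7)
          hab.ne' (by linarith) hp8 hp9
          (by linear_combination e031) (by linear_combination e301) (by linear_combination e121)
          (by linear_combination e211) (by linear_combination e021) (by linear_combination e201)
          e111 e011 e101).elim
  · obtain ⟨h0, h1, h2, h3, h4, h5, h7, h8, h9⟩ := coeff_eq_zero_of_zz_ne_zero (a := a) (b := b)
      (p0 := p 0) (p1 := p 1) (p2 := p 2) (p3 := p 3) (p4 := p 4) (p5 := p 5) (p6 := p 6)
      (p7 := p 7) (p8 := p 8) (p9 := p 9) (k0 := k 0) (k1 := k 1) (k2 := k 2) (k3 := k 3)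
      (k4 := k 4) (k5 := k 5) (k6 := k 6) (k7 := k 7) (k8 := k 8) (k9 := k 9)
      hp6 e004 e013 e103
      (by linear_combination e022) (by linear_combination e202) e112
      (by linear_combination e031) (by linear_combination e301) (by linear_combination e040)
      (by linear_combination e400) (by linear_combination e130) e003 e012 e102
      (by linear_combination e021) (by linear_combination e210) (by linear_combination e120)
      e002 (by linear_combination e020)
    exact ⟨6, by decide, fun j hj => by
      fin_cases j <;> first | assumption | exact absurd rfl hj⟩

/-- Every degree-2 Darboux polynomial of the system is a nonzero scalar multiple of one
of the six monomials `x²`, `y²`, `z²`, `xy`, `xz`, `yz`. -/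
theorem stmt_15 (f : MvPolynomial (Fin 3) ℝ) (hf : f.totalDegree = 2)
    (h : ∃ k : MvPolynomial (Fin 3) ℝ, k.totalDegree ≤ 2 ∧ IsDarboux f k) :
    ∃ c : ℝ, c ≠ 0 ∧
      (f = C c * X 0 ^ 2 ∨ f = C c * X 1 ^ 2 ∨ f = C c * X 2 ^ 2 ∨
       f = C c * (X 0 * X 1) ∨ f = C c * (X 0 * X 2) ∨ f = C c * (X 1 * X 2)) := by
  obtain ⟨k, hk, hfk⟩ := h
  obtain ⟨p, rfl⟩ := exists_eq_quadratic_of_totalDegree_le f hf.le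
  obtain ⟨k, rfl⟩ := exists_eq_quadratic_of_totalDegree_le k hk
  have hsqrt : (2 : ℝ) < Real.sqrt 13 := Real.lt_sqrt_of_sq_lt (by norm_num)
  have hp : ∃ i, 4 ≤ i ∧ p i ≠ 0 := by
    by_contra! hp
    have := totalDegree_quadratic_le_one p hp
    omega
  obtain ⟨i, hi, hpi⟩ := exists_forall_ne_coeff_eq_zero (by positivity)
    (one_div_lt_one_div_of_lt (by linarith) (by linarith)) (darbouxCoeff_eq_zero p k hfk) hp
  refine ⟨p i, ?_, ?_⟩
  · obtain ⟨j, _, hpj⟩ := hp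
    rwa [← not_imp_comm.1 (hpi j) hpj]
  · have hC (j : Fin 10) (hj : j ≠ i) : p j = 0 := hpi j hj
    fin_cases i <;> simp_all [quadratic]

end
end

section
/- Let α = √13 − 2, β = √13 + 2, and let P : ℝ³ → ℝ³ be P(x,y,z) = ( x(−x²/2 + x/α − y²/4), y(−x²/4 + y/β − y²/2), −z(x²+y²)/4 ). For (x,y,z) with x ≥ 0, y ≥ 0, z ≥ 0, one has P(x,y,z) = 0 if and only if one of the following holds: (i) x = y = 0 (z arbitrary); (ii) z = 0 and (x,y) = (2/α, 0); (iii) z = 0 and (x,y) = (0, 2/β); (iv) z = 0, x > 0, y > 0, and −x²/2 + x/α − y²/4 = 0 and −x²/4 + y/β − y²/2 = 0. Moreover, there exists at least one pair (x,y) with x > 0 and y > 0 satisfying the two equations in (iv). -/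
noncomputable section

/-- The time-rescaled homogeneous Ricci flow system on `𝔽_{α₂}`. -/
def P16 (x y z : ℝ) : ℝ × ℝ × ℝ :=
  (x * (-x ^ 2 / 2 + x / (Real.sqrt 13 - 2) - y ^ 2 / 4),
   y * (-x ^ 2 / 4 + y / (Real.sqrt 13 + 2) - y ^ 2 / 2),
   -z * (x ^ 2 + y ^ 2) / 4)

/-- Along the line `y = t * x` the two planar equilibrium equations reduce to a cubic in `t`,
which has a positive root. -/
theorem exists_pos_planar_equilibrium {α β : ℝ} (hα : 0 < α) (hβ : 0 < β) :
    ∃ x y : ℝ, 0 < x ∧ 0 < y ∧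
      -x ^ 2 / 2 + x / α - y ^ 2 / 4 = 0 ∧ -x ^ 2 / 4 + y / β - y ^ 2 / 2 = 0 := by
  have hT : (0 : ℝ) < 1 + 2 * β / α := by positivity
  have hcont : ContinuousOn (fun t : ℝ => α * t * (2 + t ^ 2) - β * (1 + 2 * t ^ 2))
      (Set.Icc 0 (1 + 2 * β / α)) := by fun_prop
  have hend : 0 < α * (1 + 2 * β / α) * (2 + (1 + 2 * β / α) ^ 2)
      - β * (1 + 2 * (1 + 2 * β / α) ^ 2) := by
    have h : α * (1 + 2 * β / α) = α + 2 * β := by field_simp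
    rw [h]
    nlinarith [mul_pos hα (pow_pos hT 2)]
  obtain ⟨t, ht, hroot⟩ := intermediate_value_Ioo hT.le hcont
    (show (0 : ℝ) ∈ Set.Ioo _ _ from ⟨by simpa using hβ, hend⟩)
  have ht0 : 0 < t := ht.1
  refine ⟨4 / (α * (2 + t ^ 2)), t * (4 / (α * (2 + t ^ 2))), by positivity, by positivity, ?_, ?_⟩
  · field_simp
    ring
  · have hroot' : α * t * (2 + t ^ 2) - β * (1 + 2 * t ^ 2) = 0 := hroot
    field_simp
    linear_combination 8 * hroot'

/-- Classification of the equilibria of the system in the closed positive octant, and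
existence of the interior planar equilibrium `q₃`. -/
theorem stmt_16 :
    (∀ x y z : ℝ, 0 ≤ x → 0 ≤ y → 0 ≤ z →
      (P16 x y z = (0, 0, 0) ↔
        ((x = 0 ∧ y = 0) ∨
         (z = 0 ∧ x = 2 / (Real.sqrt 13 - 2) ∧ y = 0) ∨
         (z = 0 ∧ x = 0 ∧ y = 2 / (Real.sqrt 13 + 2)) ∨
         (z = 0 ∧ 0 < x ∧ 0 < y ∧
           -x ^ 2 / 2 + x / (Real.sqrt 13 - 2) - y ^ 2 / 4 = 0 ∧
           -x ^ 2 / 4 + y / (Real.sqrt 13 + 2) - y ^ 2 / 2 = 0)))) ∧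
    ∃ x y : ℝ, 0 < x ∧ 0 < y ∧
      -x ^ 2 / 2 + x / (Real.sqrt 13 - 2) - y ^ 2 / 4 = 0 ∧
      -x ^ 2 / 4 + y / (Real.sqrt 13 + 2) - y ^ 2 / 2 = 0 := by
  have hsqrt : 2 < Real.sqrt 13 := Real.lt_sqrt_of_sq_lt (by norm_num)
  have hα : 0 < Real.sqrt 13 - 2 := by linarith
  have hβ : 0 < Real.sqrt 13 + 2 := by linarith
  refine ⟨?_, exists_pos_planar_equilibrium hα hβ⟩
  generalize hα' : Real.sqrt 13 - 2 = α at *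
  generalize hβ' : Real.sqrt 13 + 2 = β at *
  intro x y z hx hy _
  simp only [P16, hα', hβ', Prod.mk.injEq]
  constructor
  · rintro ⟨h₁, h₂, h₃⟩
    have hz : 0 < x ^ 2 + y ^ 2 → z = 0 := fun h => by simpa [h.ne'] using h₃
    rcases hx.eq_or_lt' with rfl | hx <;> rcases hy.eq_or_lt' with rfl | hy
    · exact Or.inl ⟨rfl, rfl⟩
    · have h := (mul_eq_zero.mp h₂).resolve_left hy.ne'
      refine Or.inr (Or.inr (Or.inl ⟨hz (by positivity), rfl, ?_⟩))
      field_simp at h ⊢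
      exact mul_left_cancel₀ hy.ne' (by linarith)
    · have h := (mul_eq_zero.mp h₁).resolve_left hx.ne'
      refine Or.inr (Or.inl ⟨hz (by positivity), ?_, rfl⟩)
      field_simp at h ⊢
      exact mul_left_cancel₀ hx.ne' (by linarith)
    · exact Or.inr (Or.inr (Or.inr ⟨hz (by positivity), hx, hy, (mul_eq_zero.mp h₁).resolve_left hx.ne',
        (mul_eq_zero.mp h₂).resolve_left hy.ne'⟩))
  · rintro (⟨rfl, rfl⟩ | ⟨rfl, rfl, rfl⟩ | ⟨rfl, rfl, rfl⟩ | ⟨rfl, -, -, h₁, h₂⟩)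
    · simp
    · refine ⟨?_, by simp, by simp⟩
      field_simp
      ring
    · refine ⟨by simp, ?_, by simp⟩
      field_simp
      ring
    · simp [h₁, h₂]

end
end

section
/- Let α = √13 − 2, β = √13 + 2, and let P : ℝ³ → ℝ³ be P(x,y,z) = ( x(−x²/2 + x/α − y²/4), y(−x²/4 + y/β − y²/2), −z(x²+y²)/4 ). Then P is differentiable and its total derivative (Jacobian matrix) at q₁ = (2/α, 0, 0) is the diagonal matrix diag(−2/α², −1/α², −1/α²), and at q₂ = (0, 2/β, 0) it is the diagonal matrix diag(−1/β², −2/β², −1/β²). In particular all eigenvalues of the linearization at q₁ and at q₂ are negative, so q₁ and q₂ are hyperbolic attracting equilibrium points. -/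
noncomputable section

/-- The time-rescaled homogeneous Ricci flow system on `𝔽_{α₂}` as a map `ℝ³ → ℝ³`. -/
def P17 : (Fin 3 → ℝ) → (Fin 3 → ℝ) := fun v =>
  ![v 0 * (-(v 0) ^ 2 / 2 + v 0 / (Real.sqrt 13 - 2) - (v 1) ^ 2 / 4),
    v 1 * (-(v 0) ^ 2 / 4 + v 1 / (Real.sqrt 13 + 2) - (v 1) ^ 2 / 2),
    -(v 2) * ((v 0) ^ 2 + (v 1) ^ 2) / 4]

/-- The Jacobian matrix of the linearization at `q₁`. -/
def J1 : Matrix (Fin 3) (Fin 3) ℝ :=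
  Matrix.diagonal ![-2 / (Real.sqrt 13 - 2) ^ 2, -1 / (Real.sqrt 13 - 2) ^ 2,
    -1 / (Real.sqrt 13 - 2) ^ 2]

/-- The Jacobian matrix of the linearization at `q₂`. -/
def J2 : Matrix (Fin 3) (Fin 3) ℝ :=
  Matrix.diagonal ![-1 / (Real.sqrt 13 + 2) ^ 2, -2 / (Real.sqrt 13 + 2) ^ 2,
    -1 / (Real.sqrt 13 + 2) ^ 2]

/-- The Jacobian matrix of `P17` at an arbitrary point. -/
def jacobianP17 (v : Fin 3 → ℝ) : Matrix (Fin 3) (Fin 3) ℝ :=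
  !![-3 / 2 * v 0 ^ 2 + 2 * v 0 / (Real.sqrt 13 - 2) - v 1 ^ 2 / 4, -(v 0 * v 1) / 2, 0;
    -(v 0 * v 1) / 2, -v 0 ^ 2 / 4 + 2 * v 1 / (Real.sqrt 13 + 2) - 3 / 2 * v 1 ^ 2, 0;
    -(v 0 * v 2) / 2, -(v 1 * v 2) / 2, -(v 0 ^ 2 + v 1 ^ 2) / 4]

theorem hasFDerivAt_P17 (v : Fin 3 → ℝ) :
    HasFDerivAt P17 (LinearMap.toContinuousLinearMap (Matrix.toLin' (jacobianP17 v))) v := by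
  have h (i : Fin 3) : HasFDerivAt (fun w : Fin 3 → ℝ => w i)
      (ContinuousLinearMap.proj i : (Fin 3 → ℝ) →L[ℝ] ℝ) v := hasFDerivAt_apply i v
  rw [hasFDerivAt_pi']
  intro i
  fin_cases i
  · refine ((h 0).mul (((((h 0).pow 2).neg.mul_const 2⁻¹).add
      ((h 0).mul_const (Real.sqrt 13 - 2)⁻¹)).sub (((h 1).pow 2).mul_const 4⁻¹))).congr_fderiv ?_
    ext w
    simp [jacobianP17, dotProduct, Fin.sum_univ_three]
    ring
  · refine ((h 1).mul (((((h 0).pow 2).neg.mul_const 4⁻¹).add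
      ((h 1).mul_const (Real.sqrt 13 + 2)⁻¹)).sub (((h 1).pow 2).mul_const 2⁻¹))).congr_fderiv ?_
    ext w
    simp [jacobianP17, dotProduct, Fin.sum_univ_three]
    ring
  · refine (((h 2).neg.mul (((h 0).pow 2).add ((h 1).pow 2))).mul_const 4⁻¹).congr_fderiv ?_
    ext w
    simp [jacobianP17, dotProduct, Fin.sum_univ_three]
    ring

theorem sqrt_thirteen_sub_two_pos : 0 < Real.sqrt 13 - 2 :=
  sub_pos.2 (Real.lt_sqrt_of_sq_lt (by norm_num))

theorem jacobianP17_left : jacobianP17 ![2 / (Real.sqrt 13 - 2), 0, 0] = J1 := by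
  have h := sqrt_thirteen_sub_two_pos.ne'
  ext i j
  fin_cases i <;> fin_cases j <;> simp [jacobianP17, J1] <;> field_simp <;> norm_num

theorem jacobianP17_right : jacobianP17 ![0, 2 / (Real.sqrt 13 + 2), 0] = J2 := by
  have h : Real.sqrt 13 + 2 ≠ 0 := by positivity
  ext i j
  fin_cases i <;> fin_cases j <;> simp [jacobianP17, J2] <;> field_simp <;> norm_num

/-- `q₁` and `q₂` are equilibria, `P` is differentiable with the indicated diagonal
Jacobian matrices there, and all eigenvalues of these linearizations are negative. -/
theorem stmt_17 :
    Differentiable ℝ P17 ∧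
    P17 ![2 / (Real.sqrt 13 - 2), 0, 0] = 0 ∧
    P17 ![0, 2 / (Real.sqrt 13 + 2), 0] = 0 ∧
    HasFDerivAt P17 (LinearMap.toContinuousLinearMap (Matrix.toLin' J1))
      ![2 / (Real.sqrt 13 - 2), 0, 0] ∧
    HasFDerivAt P17 (LinearMap.toContinuousLinearMap (Matrix.toLin' J2))
      ![0, 2 / (Real.sqrt 13 + 2), 0] ∧
    (∀ μ : ℝ, Module.End.HasEigenvalue (Matrix.toLin' J1) μ → μ < 0) ∧
    (∀ μ : ℝ, Module.End.HasEigenvalue (Matrix.toLin' J2) μ → μ < 0) := by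
  have ha := sqrt_thirteen_sub_two_pos
  have hb : 0 < Real.sqrt 13 + 2 := by positivity
  refine ⟨fun v => (hasFDerivAt_P17 v).differentiableAt, ?_, ?_,
    jacobianP17_left ▸ hasFDerivAt_P17 _, jacobianP17_right ▸ hasFDerivAt_P17 _, ?_, ?_⟩
  · ext i
    fin_cases i <;> simp [P17]
    field_simp
    norm_num
  · ext i
    fin_cases i <;> simp [P17]
    field_simp
    norm_num
  · intro μ hμ
    obtain ⟨i, rfl⟩ := (hasEigenvalue_toLin'_diagonal_iff _).1 hμ
    fin_cases i <;> exact div_neg_of_neg_of_pos (by norm_num) (pow_pos ha 2)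
  · intro μ hμ
    obtain ⟨i, rfl⟩ := (hasEigenvalue_toLin'_diagonal_iff _).1 hμ
    fin_cases i <;> exact div_neg_of_neg_of_pos (by norm_num) (pow_pos hb 2)

end
end

section
/- Let α = √13 − 2, β = √13 + 2, and let Q : ℝ³ → ℝ³ be the vector field Q(z₁,z₂,z₃) = ( z₁((1−z₁²)/4 − z₃/α + z₁z₃/β), z₂(1/4 − z₃/α), (z₃/4)(2 + z₁² − 4z₃/α) ). Then: (i) the zeros of Q lying in the plane z₃ = 0 are exactly (0,0,0), (1,0,0) and (−1,0,0); (ii) the Jacobian matrix of Q at the origin is diag(1/4, 1/4, 1/2), so the origin is a hyperbolic source; (iii) at each of (1,0,0) and (−1,0,0) the Jacobian matrix of Q is upper triangular with diagonal entries −1/2, 1/4, 3/4, hence has eigenvalues −1/2, 1/4 and 3/4, so these are hyperbolic saddle points. -/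
noncomputable section

/-- The Poincaré compactification of the time-rescaled homogeneous Ricci flow system
in the chart `U₁`. -/
def Q18 : (Fin 3 → ℝ) → (Fin 3 → ℝ) := fun v =>
  ![v 0 * ((1 - (v 0) ^ 2) / 4 - v 2 / (Real.sqrt 13 - 2) +
      v 0 * v 2 / (Real.sqrt 13 + 2)),
    v 1 * (1 / 4 - v 2 / (Real.sqrt 13 - 2)),
    v 2 / 4 * (2 + (v 0) ^ 2 - 4 * v 2 / (Real.sqrt 13 - 2))]

/-- The eigenvalues of an upper triangular matrix are its diagonal entries. -/
theorem Matrix.IsUpperTriangular.hasEigenvalue_toLin'_iff {K n : Type*} [Field K] [Fintype n]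
    [LinearOrder n] {M : Matrix n n K} (hM : M.IsUpperTriangular) (μ : K) :
    Module.End.HasEigenvalue (Matrix.toLin' M) μ ↔ ∃ i, μ = M i i := by
  rw [Module.End.hasEigenvalue_iff_isRoot_charpoly, Matrix.charpoly_toLin',
    Matrix.charpoly_of_isUpperTriangular M hM, Polynomial.isRoot_prod]
  simp [sub_eq_zero]

/-- The Jacobian matrix of `Q18` at `v`. -/
def Q18Jacobian (v : Fin 3 → ℝ) : Matrix (Fin 3) (Fin 3) ℝ :=
  !![(1 - 3 * v 0 ^ 2) / 4 - v 2 / (Real.sqrt 13 - 2) + 2 * v 0 * v 2 / (Real.sqrt 13 + 2), 0,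
      -v 0 / (Real.sqrt 13 - 2) + v 0 ^ 2 / (Real.sqrt 13 + 2);
    0, 1 / 4 - v 2 / (Real.sqrt 13 - 2), -v 1 / (Real.sqrt 13 - 2);
    v 0 * v 2 / 2, 0, (2 + v 0 ^ 2 - 8 * v 2 / (Real.sqrt 13 - 2)) / 4]

theorem hasFDerivAt_Q18 (v : Fin 3 → ℝ) :
    HasFDerivAt Q18 (LinearMap.toContinuousLinearMap (Matrix.toLin' (Q18Jacobian v))) v := by
  have h0 := hasFDerivAt_apply (𝕜 := ℝ) (0 : Fin 3) v
  have h1 := hasFDerivAt_apply (𝕜 := ℝ) (1 : Fin 3) v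
  have h2 := hasFDerivAt_apply (𝕜 := ℝ) (2 : Fin 3) v
  have hα := h2.mul_const (Real.sqrt 13 - 2)⁻¹
  rw [hasFDerivAt_pi']
  intro i
  fin_cases i
  · refine (h0.mul (((((h0.pow 2).const_sub 1).mul_const (4 : ℝ)⁻¹).sub hα).add
      ((h0.mul h2).mul_const (Real.sqrt 13 + 2)⁻¹))).congr_fderiv ?_
    ext w
    simp [Q18Jacobian, dotProduct, Fin.sum_univ_three]
    ring
  · refine (h1.mul (hα.const_sub (1 / 4))).congr_fderiv ?_
    ext w
    simp [Q18Jacobian, dotProduct, Fin.sum_univ_three]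
    ring
  · refine ((h2.mul_const (4 : ℝ)⁻¹).mul (((h0.pow 2).const_add 2).sub
      ((h2.const_mul 4).mul_const (Real.sqrt 13 - 2)⁻¹))).congr_fderiv ?_
    ext w
    simp [Q18Jacobian, dotProduct, Fin.sum_univ_three]
    ring

theorem Q18_eq_zero_and_iff (v : Fin 3 → ℝ) :
    (Q18 v = 0 ∧ v 2 = 0) ↔ (v = ![0, 0, 0] ∨ v = ![1, 0, 0] ∨ v = ![-1, 0, 0]) := by
  constructor
  · rintro ⟨hQ, h2⟩
    have e0 := congrFun hQ 0
    have e1 := congrFun hQ 1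
    simp [Q18, h2] at e0 e1
    have hv (c : ℝ) (hc : v 0 = c) : v = ![c, 0, 0] := by
      ext i
      fin_cases i <;> simp [hc, e1, h2]
    rcases e0 with h | h
    · exact Or.inl (hv 0 h)
    · rcases sq_eq_one_iff.mp (sub_eq_zero.mp h).symm with h | h
      · exact Or.inr (Or.inl (hv 1 h))
      · exact Or.inr (Or.inr (hv (-1) h))
  · rintro (rfl | rfl | rfl) <;> refine ⟨?_, by simp⟩ <;> ext i <;> fin_cases i <;> simp [Q18]

theorem Q18_saddle {c : ℝ} (hc : c ^ 2 = 1) :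
    ∃ J : Matrix (Fin 3) (Fin 3) ℝ,
      HasFDerivAt Q18 (LinearMap.toContinuousLinearMap (Matrix.toLin' J)) ![c, 0, 0] ∧
      (∀ i j : Fin 3, j < i → J i j = 0) ∧
      J 0 0 = -1 / 2 ∧ J 1 1 = 1 / 4 ∧ J 2 2 = 3 / 4 ∧
      (∀ μ : ℝ, Module.End.HasEigenvalue (Matrix.toLin' J) μ ↔
        (μ = -1 / 2 ∨ μ = 1 / 4 ∨ μ = 3 / 4)) := by
  have hJ : ∀ i j : Fin 3, j < i → Q18Jacobian ![c, 0, 0] i j = 0 := by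
    intro i j hij
    fin_cases i <;> fin_cases j <;> simp [Q18Jacobian] at hij ⊢
  have d0 : Q18Jacobian ![c, 0, 0] 0 0 = -1 / 2 := by simp [Q18Jacobian, hc]; norm_num
  have d1 : Q18Jacobian ![c, 0, 0] 1 1 = 1 / 4 := by simp [Q18Jacobian]
  have d2 : Q18Jacobian ![c, 0, 0] 2 2 = 3 / 4 := by simp [Q18Jacobian, hc]; norm_num
  refine ⟨_, hasFDerivAt_Q18 _, hJ, d0, d1, d2, fun μ => ?_⟩
  rw [Matrix.IsUpperTriangular.hasEigenvalue_toLin'_iff (fun i j hij => hJ i j hij)]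
  simp [Fin.exists_fin_succ, d0, d1, d2]

/-- Zeros of `Q` in the plane `z₃ = 0`, Jacobian at the origin, and the upper
triangular Jacobians with eigenvalues `−1/2, 1/4, 3/4` at `(±1,0,0)`. -/
theorem stmt_18 :
    (∀ v : Fin 3 → ℝ, (Q18 v = 0 ∧ v 2 = 0) ↔
      (v = ![0, 0, 0] ∨ v = ![1, 0, 0] ∨ v = ![-1, 0, 0])) ∧
    HasFDerivAt Q18
      (LinearMap.toContinuousLinearMap
        (Matrix.toLin' (Matrix.diagonal ![(1 : ℝ) / 4, 1 / 4, 1 / 2]))) ![0, 0, 0] ∧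
    (∃ J : Matrix (Fin 3) (Fin 3) ℝ,
      HasFDerivAt Q18 (LinearMap.toContinuousLinearMap (Matrix.toLin' J)) ![1, 0, 0] ∧
      (∀ i j : Fin 3, j < i → J i j = 0) ∧
      J 0 0 = -1 / 2 ∧ J 1 1 = 1 / 4 ∧ J 2 2 = 3 / 4 ∧
      (∀ μ : ℝ, Module.End.HasEigenvalue (Matrix.toLin' J) μ ↔
        (μ = -1 / 2 ∨ μ = 1 / 4 ∨ μ = 3 / 4))) ∧
    (∃ J : Matrix (Fin 3) (Fin 3) ℝ,
      HasFDerivAt Q18 (LinearMap.toContinuousLinearMap (Matrix.toLin' J)) ![-1, 0, 0] ∧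
      (∀ i j : Fin 3, j < i → J i j = 0) ∧
      J 0 0 = -1 / 2 ∧ J 1 1 = 1 / 4 ∧ J 2 2 = 3 / 4 ∧
      (∀ μ : ℝ, Module.End.HasEigenvalue (Matrix.toLin' J) μ ↔
        (μ = -1 / 2 ∨ μ = 1 / 4 ∨ μ = 3 / 4))) := by
  refine ⟨Q18_eq_zero_and_iff, ?_, Q18_saddle (by norm_num), Q18_saddle (by norm_num)⟩
  have hJ : Q18Jacobian ![0, 0, 0] = Matrix.diagonal ![(1 : ℝ) / 4, 1 / 4, 1 / 2] := by
    ext i j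
    fin_cases i <;> fin_cases j <;> simp [Q18Jacobian]
    norm_num
  exact hJ ▸ hasFDerivAt_Q18 ![0, 0, 0]

end
end

section
/- Let α = √13 − 2, β = √13 + 2, and let F : ℝ³ → ℝ³ be the vector field F(x₁, r₁, z₁) = ( x₁(r₁(1−x₁²)/4 − 1/β + x₁/α), −r₁((2+x₁²)r₁/4 − 1/β), −r₁z₁(1+x₁²)/4 ). Then for every z* ∈ ℝ the points p⁻ = (0, 0, z*) and p⁺ = (α/β, 0, z*) are zeros of F; the Jacobian matrix of F at p⁻ has eigenvalues 0, 1/β and −1/β, and the Jacobian matrix of F at p⁺ has characteristic polynomial t·(t − 1/β)², i.e. eigenvalues 0, 1/β, 1/β. -/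
noncomputable section

open Polynomial

/-- The desingularized blow-up system obtained from the time-rescaled homogeneous
Ricci flow system, in the coordinates `(x₁, r₁, z₁)`. -/
def F19 : (Fin 3 → ℝ) → (Fin 3 → ℝ) := fun v =>
  ![v 0 * (v 1 * (1 - (v 0) ^ 2) / 4 - 1 / (Real.sqrt 13 + 2) +
      v 0 / (Real.sqrt 13 - 2)),
    -(v 1) * ((2 + (v 0) ^ 2) * v 1 / 4 - 1 / (Real.sqrt 13 + 2)),
    -(v 1) * v 2 * (1 + (v 0) ^ 2) / 4]

/-- The Jacobian matrix of `F19` at `v`. -/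
def jacobianF19 (v : Fin 3 → ℝ) : Matrix (Fin 3) (Fin 3) ℝ :=
  !![v 1 * (1 - 3 * (v 0) ^ 2) / 4 - 1 / (Real.sqrt 13 + 2) + 2 * v 0 / (Real.sqrt 13 - 2),
      v 0 * (1 - (v 0) ^ 2) / 4, 0;
    -(v 0 * (v 1) ^ 2) / 2, -((2 + (v 0) ^ 2) * v 1) / 2 + 1 / (Real.sqrt 13 + 2), 0;
    -(v 0 * v 1 * v 2) / 2, -(v 2 * (1 + (v 0) ^ 2)) / 4, -(v 1 * (1 + (v 0) ^ 2)) / 4]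

theorem hasFDerivAt_F19 (v : Fin 3 → ℝ) :
    HasFDerivAt F19 (LinearMap.toContinuousLinearMap (Matrix.toLin' (jacobianF19 v))) v := by
  have h0 := hasFDerivAt_apply (𝕜 := ℝ) (F' := fun _ : Fin 3 => ℝ) 0 v
  have h1 := hasFDerivAt_apply (𝕜 := ℝ) (F' := fun _ : Fin 3 => ℝ) 1 v
  have h2 := hasFDerivAt_apply (𝕜 := ℝ) (F' := fun _ : Fin 3 => ℝ) 2 v
  rw [hasFDerivAt_pi']
  intro i
  fin_cases i
  · refine (h0.mul ((((h1.mul ((h0.pow 2).const_sub 1)).mul_const (1 / 4)).sub_const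
      (1 / (Real.sqrt 13 + 2))).add (h0.mul_const (1 / (Real.sqrt 13 - 2))))).congr_fderiv ?_
      |>.congr_of_eventuallyEq (.of_forall fun w => ?_)
    · ext w
      simp [jacobianF19, Fin.sum_univ_three, dotProduct]
      ring
    · simp [F19]
      left
      ring
  · refine (h1.neg.mul (((((h0.pow 2).const_add 2).mul h1).mul_const (1 / 4)).sub_const
      (1 / (Real.sqrt 13 + 2)))).congr_fderiv ?_
      |>.congr_of_eventuallyEq (.of_forall fun w => ?_)
    · ext w
      simp [jacobianF19, Fin.sum_univ_three, dotProduct]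
      ring
    · simp [F19]
      left
      ring
  · refine (((h1.neg.mul h2).mul ((h0.pow 2).const_add 1)).mul_const (1 / 4)).congr_fderiv ?_
      |>.congr_of_eventuallyEq (.of_forall fun w => ?_)
    · ext w
      simp [jacobianF19, Fin.sum_univ_three, dotProduct]
      ring
    · simp [F19]
      ring

theorem charpoly_jacobianF19_of_radius_zero (x z : ℝ) :
    (jacobianF19 ![x, 0, z]).charpoly =
      X * (X - C (2 * x / (Real.sqrt 13 - 2) - 1 / (Real.sqrt 13 + 2))) *
        (X - C (1 / (Real.sqrt 13 + 2))) := by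
  rw [Matrix.charpoly, Matrix.det_fin_three]
  simp [jacobianF19]
  ring

theorem two_lt_sqrt_thirteen : 2 < Real.sqrt 13 :=
  Real.lt_sqrt_of_sq_lt (by norm_num)

/-- The points `p⁻ = (0,0,z*)` and `p⁺ = (α/β,0,z*)` are zeros of `F`; the Jacobian at
`p⁻` has characteristic polynomial `t(t − 1/β)(t + 1/β)` (eigenvalues `0, 1/β, −1/β`),
and the Jacobian at `p⁺` has characteristic polynomial `t(t − 1/β)²`. -/
theorem stmt_19 (zs : ℝ) :
    F19 ![0, 0, zs] = 0 ∧
    F19 ![(Real.sqrt 13 - 2) / (Real.sqrt 13 + 2), 0, zs] = 0 ∧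
    (∃ J : Matrix (Fin 3) (Fin 3) ℝ,
      HasFDerivAt F19 (LinearMap.toContinuousLinearMap (Matrix.toLin' J)) ![0, 0, zs] ∧
      J.charpoly = Polynomial.X * (Polynomial.X - Polynomial.C (1 / (Real.sqrt 13 + 2))) *
        (Polynomial.X + Polynomial.C (1 / (Real.sqrt 13 + 2)))) ∧
    (∃ J : Matrix (Fin 3) (Fin 3) ℝ,
      HasFDerivAt F19 (LinearMap.toContinuousLinearMap (Matrix.toLin' J))
        ![(Real.sqrt 13 - 2) / (Real.sqrt 13 + 2), 0, zs] ∧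
      J.charpoly = Polynomial.X *
        (Polynomial.X - Polynomial.C (1 / (Real.sqrt 13 + 2))) ^ 2) := by
  have hα : Real.sqrt 13 - 2 ≠ 0 := (sub_pos.mpr two_lt_sqrt_thirteen).ne'
  have hβ : Real.sqrt 13 + 2 ≠ 0 := by positivity
  refine ⟨?_, ?_, ⟨_, hasFDerivAt_F19 _, ?_⟩, ⟨_, hasFDerivAt_F19 _, ?_⟩⟩
  · ext i
    fin_cases i <;> simp [F19]
  · ext i
    fin_cases i <;> simp [F19]
    right
    field_simp
    ring
  · rw [charpoly_jacobianF19_of_radius_zero]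
    simp
    ring
  · have hb : 2 * ((Real.sqrt 13 - 2) / (Real.sqrt 13 + 2)) / (Real.sqrt 13 - 2) -
        1 / (Real.sqrt 13 + 2) = 1 / (Real.sqrt 13 + 2) := by
      field_simp
      ring
    rw [charpoly_jacobianF19_of_radius_zero, hb]
    ring

end
end
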